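/- arXiv:2206.04752 — 4 statements merged into one kernel-verified Lean document; each statement's English description precedes it below -/
import Mathlib

section
/- Let A_1 = (1, 2, 3, 4, 5, 6, …) be the sequence of consecutive positive integers (a_i = i). Then for every integer n > 79, one has p_{A_1}(n,6)² > p_{A_1}(n+1,6)·p_{A_1}(n−1,6). -/
/-- The restricted partition function `p_A(n,k)` for the sequence `a` (0-indexed, so the
paper's `a_i` is `a (i-1)`): the number of `k`-tuples `(c_0,…,c_{k-1})` of nonnegative
integers with `c_0·a_0 + ⋯ + c_{k-1}·a_{k-1} = n`.
It equals `0` for `n < 0` and `1` for `n = 0`. -/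
noncomputable def pA (a : ℕ → ℕ) (k : ℕ) (n : ℤ) : ℕ :=
  Set.ncard {c : Fin k → ℕ | (∑ i, (c i : ℤ) * (a i.val : ℤ)) = n}

open fwdDiff Finset

/-! ### The recurrence for the restricted partition function -/

section Recurrence

variable {a : ℕ → ℕ}

lemma pA_set_finite (ha : ∀ i, 0 < a i) (k : ℕ) (n : ℤ) :
    {c : Fin k → ℕ | (∑ i, (c i : ℤ) * (a i.val : ℤ)) = n}.Finite := by
  refine (Set.finite_Iic (fun _ : Fin k => n.toNat)).subset fun c hc i => ?_
  have h1 : (c i : ℤ) * (a i.val : ℤ) ≤ n := by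
    rw [← (hc : _ = n)]
    exact single_le_sum (f := fun i : Fin k => (c i : ℤ) * (a i.val : ℤ))
      (fun _ _ => by positivity) (mem_univ i)
  have h2 : (1 : ℤ) ≤ a i.val := by exact_mod_cast ha i.val
  have h3 : (0 : ℤ) ≤ c i := by positivity
  have h4 : (c i : ℤ) ≤ n := by nlinarith
  change c i ≤ n.toNat
  omega

lemma pA_of_neg (k : ℕ) {n : ℤ} (hn : n < 0) : pA a k n = 0 := by
  have : {c : Fin k → ℕ | (∑ i, (c i : ℤ) * (a i.val : ℤ)) = n} = ∅ := by
    refine Set.eq_empty_of_forall_notMem fun c hc => ?_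
    have : 0 ≤ ∑ i, (c i : ℤ) * (a i.val : ℤ) := sum_nonneg fun _ _ => by positivity
    rw [(hc : _ = n)] at this
    omega
  rw [pA, this, Set.ncard_empty]

lemma pA_zero_left (n : ℤ) : pA a 0 n = if n = 0 then 1 else 0 := by
  split_ifs with h
  · simp [pA, h]
  · simp [pA, Ne.symm h]

lemma pA_succ (ha : ∀ i, 0 < a i) (k : ℕ) (n : ℤ) :
    pA a (k + 1) n = pA a k n + pA a (k + 1) (n - a k) := by
  have hsplit : {c : Fin (k + 1) → ℕ | (∑ i, (c i : ℤ) * (a i.val : ℤ)) = n} =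
      (fun c : Fin k → ℕ => (Fin.snoc c 0 : Fin (k + 1) → ℕ)) ''
          {c : Fin k → ℕ | (∑ i, (c i : ℤ) * (a i.val : ℤ)) = n} ∪
        (fun c : Fin (k + 1) → ℕ => c + Pi.single (Fin.last k) 1) ''
          {c : Fin (k + 1) → ℕ | (∑ i, (c i : ℤ) * (a i.val : ℤ)) = n - a k} := by
    ext c
    simp only [Set.mem_union, Set.mem_image, Set.mem_ofPred_eq]
    constructor
    · intro hc
      rcases Nat.eq_zero_or_pos (c (Fin.last k)) with h0 | h0
      · left
        refine ⟨Fin.init c, ?_, ?_⟩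
        · rw [Fin.sum_univ_castSucc] at hc
          simpa [h0, Fin.init] using hc
        · rw [← h0, Fin.snoc_init_self]
      · right
        have h1 : c - Pi.single (Fin.last k) 1 + Pi.single (Fin.last k) 1 = c := by
          refine tsub_add_cancel_of_le fun i => ?_
          by_cases hi : i = Fin.last k
          · subst hi; simpa using Nat.succ_le_of_lt h0
          · simp [hi]
        refine ⟨c - Pi.single (Fin.last k) 1, ?_, h1⟩
        generalize c - Pi.single (Fin.last k) 1 = d at h1 ⊢
        subst h1
        simp only [Pi.add_apply, Nat.cast_add, add_mul, sum_add_distrib] at hc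
        rw [← hc, Fintype.sum_eq_single (a := Fin.last k)
          (f := fun i => ((Pi.single (Fin.last k) 1 : Fin (k + 1) → ℕ) i : ℤ) * (a i.val : ℤ))
          (by intro i hi; simp [hi])]
        simp
    · rintro (⟨c, hc, rfl⟩ | ⟨c, hc, rfl⟩)
      · rw [Fin.sum_univ_castSucc]
        simpa using hc
      · simp only [Pi.add_apply, Nat.cast_add, add_mul, sum_add_distrib]
        rw [hc, Fintype.sum_eq_single (Fin.last k) (by intro i hi; simp [hi])]
        simp
  rw [pA, hsplit, Set.ncard_union_eq ?_ ((pA_set_finite ha k n).image _)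
    ((pA_set_finite ha (k + 1) _).image _), Set.ncard_image_of_injective,
    Set.ncard_image_of_injective]
  · rfl
  · exact add_left_injective _
  · intro c d h
    simpa using congrArg Fin.init h
  · rw [Set.disjoint_left]
    rintro _ ⟨c, -, rfl⟩ ⟨d, -, h⟩
    simpa using congrFun h (Fin.last k)

end Recurrence

/-- The number of partitions of `n` into parts of size at most `k`, as an integer. -/
noncomputable def boundedPartitions (k n : ℕ) : ℤ := pA (fun i => i + 1) k n

lemma boundedPartitions_zero {n : ℕ} (hn : 0 < n) : boundedPartitions 0 n = 0 := by
  simp [boundedPartitions, pA_zero_left, hn.ne']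

lemma boundedPartitions_succ_add (k n : ℕ) :
    boundedPartitions (k + 1) (n + (k + 1)) =
      boundedPartitions k (n + (k + 1)) + boundedPartitions (k + 1) n := by
  have h := pA_succ (a := fun i => i + 1) (fun i => i.succ_pos) k ((n + (k + 1) : ℕ) : ℤ)
  rw [show ((n + (k + 1) : ℕ) : ℤ) - ((k + 1 : ℕ) : ℤ) = n by push_cast; ring] at h
  simp only [boundedPartitions]
  exact_mod_cast h

/-! ### Quasi-polynomiality -/

lemma boundedPartitions_succ_add_mul (k n m : ℕ) :
    boundedPartitions (k + 1) (n + m * (k + 1)) - boundedPartitions (k + 1) n =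
      ∑ j ∈ range m, boundedPartitions k (n + (j + 1) * (k + 1)) := by
  induction m with
  | zero => simp
  | succ m ih =>
    rw [sum_range_succ, ← ih, show n + (m + 1) * (k + 1) = n + m * (k + 1) + (k + 1) by ring,
      boundedPartitions_succ_add]
    ring

lemma fwdDiff_iter_boundedPartitions {h : ℕ} (k : ℕ) (hk : ∀ i ∈ Icc 1 k, i ∣ h) (m : ℕ)
    {n : ℕ} (hn : 0 < n) : Δ_[h] ^[k + m] (boundedPartitions k) n = 0 := by
  induction k generalizing n with
  | zero =>
    rw [fwdDiff_iter_eq_sum_shift]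
    exact sum_eq_zero fun j _ => by rw [boundedPartitions_zero (by positivity), smul_zero]
  | succ k ih =>
    obtain ⟨d, hd⟩ := hk (k + 1) (by simp)
    have hΔ : Δ_[h] (boundedPartitions (k + 1)) =
        ∑ j ∈ range d, fun n => boundedPartitions k (n + (j + 1) * (k + 1)) := by
      ext n
      rw [fwdDiff, hd, mul_comm (k + 1) d, boundedPartitions_succ_add_mul, Finset.sum_apply]
    rw [add_right_comm, Function.iterate_succ_apply, hΔ, fwdDiff_iter_finsetSum, Finset.sum_apply]
    refine sum_eq_zero fun j _ => ?_
    rw [fwdDiff_iter_comp_add]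
    exact ih (fun i hi => hk i (by simp only [mem_Icc] at hi ⊢; omega)) (by positivity)

/-! ### Polynomials as coefficient lists -/

/-- Value at `q` of the polynomial with the given coefficients, constant term first. -/
def evalCoeffs (q : ℤ) : List ℤ → ℤ
  | [] => 0
  | x :: l => x + q * evalCoeffs q l

/-- Sum of polynomials given by coefficient lists. -/
def addCoeffs : List ℤ → List ℤ → List ℤ
  | [], m => m
  | x :: l, [] => x :: l
  | x :: l, y :: m => (x + y) :: addCoeffs l m

/-- Scalar multiple of a polynomial given by a coefficient list. -/
def smulCoeffs (c : ℤ) : List ℤ → List ℤ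
  | [] => []
  | x :: l => c * x :: smulCoeffs c l

/-- Product of polynomials given by coefficient lists. -/
def mulCoeffs : List ℤ → List ℤ → List ℤ
  | [], _ => []
  | x :: l, m => addCoeffs (smulCoeffs x m) (0 :: mulCoeffs l m)

lemma evalCoeffs_add (q : ℤ) (l m : List ℤ) :
    evalCoeffs q (addCoeffs l m) = evalCoeffs q l + evalCoeffs q m := by
  fun_induction addCoeffs l m with
  | case1 => simp [evalCoeffs]
  | case2 => simp [evalCoeffs]
  | case3 x l y m ih => simp only [evalCoeffs, ih]; ring

lemma evalCoeffs_smul (q c : ℤ) (l : List ℤ) :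
    evalCoeffs q (smulCoeffs c l) = c * evalCoeffs q l := by
  induction l with
  | nil => simp [evalCoeffs, smulCoeffs]
  | cons x l ih => simp only [evalCoeffs, smulCoeffs, ih]; ring

lemma evalCoeffs_mul (q : ℤ) (l m : List ℤ) :
    evalCoeffs q (mulCoeffs l m) = evalCoeffs q l * evalCoeffs q m := by
  induction l with
  | nil => simp [evalCoeffs, mulCoeffs]
  | cons x l ih => simp only [evalCoeffs, mulCoeffs, evalCoeffs_add, evalCoeffs_smul, ih]; ring

lemma evalCoeffs_nonneg {q : ℤ} (hq : 0 ≤ q) {l : List ℤ} (hl : ∀ x ∈ l, 0 ≤ x) :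
    0 ≤ evalCoeffs q l := by
  induction l with
  | nil => simp [evalCoeffs]
  | cons x l ih =>
    simp only [List.forall_mem_cons] at hl
    exact add_nonneg hl.1 (mul_nonneg hq (ih hl.2))

lemma evalCoeffs_pos {q : ℤ} (hq : 0 ≤ q) {l : List ℤ} (h0 : 0 < l.headD 0)
    (hl : ∀ x ∈ l, 0 ≤ x) : 0 < evalCoeffs q l := by
  cases l with
  | nil => simp at h0
  | cons x l =>
    simp only [List.forall_mem_cons] at hl
    exact add_pos_of_pos_of_nonneg h0 (mul_nonneg hq (evalCoeffs_nonneg hq hl.2))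

/-! ### Newton interpolation of degree five -/

/-- Coefficients of `120` times the polynomial `∑ j < 6, (q choose j) * d j`. -/
def newtonCoeffs (d : ℕ → ℤ) : List ℤ :=
  [120 * d 0, 120 * d 1 - 60 * d 2 + 40 * d 3 - 30 * d 4 + 24 * d 5,
    60 * d 2 - 60 * d 3 + 55 * d 4 - 50 * d 5, 20 * d 3 - 30 * d 4 + 35 * d 5,
    5 * d 4 - 10 * d 5, d 5]

lemma cast_choose_succ_mul (q j : ℕ) :
    (q.choose (j + 1) : ℤ) * (j + 1) = q.choose j * (q - j) := by
  rcases le_or_gt j q with h | h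
  · have := Nat.choose_succ_right_eq q j
    zify [h] at this
    exact this
  · simp [Nat.choose_eq_zero_of_lt h, Nat.choose_eq_zero_of_lt (h.trans (Nat.lt_succ_self j))]

lemma evalCoeffs_newtonCoeffs (d : ℕ → ℤ) (q : ℕ) :
    evalCoeffs q (newtonCoeffs d) = 120 * ∑ j ∈ range 6, (q.choose j : ℤ) * d j := by
  have h1 := cast_choose_succ_mul q 0
  have h2 := cast_choose_succ_mul q 1
  have h3 := cast_choose_succ_mul q 2
  have h4 := cast_choose_succ_mul q 3
  have h5 := cast_choose_succ_mul q 4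
  norm_num at h1 h2 h3 h4 h5
  have e2 : 2 * (q.choose 2 : ℤ) = q * (q - 1) := by linarith
  have e3 : 6 * (q.choose 3 : ℤ) = q * (q - 1) * (q - 2) := by
    linear_combination 2 * h3 + (q - 2 : ℤ) * e2
  have e4 : 24 * (q.choose 4 : ℤ) = q * (q - 1) * (q - 2) * (q - 3) := by
    linear_combination 6 * h4 + (q - 3 : ℤ) * e3
  have e5 : 120 * (q.choose 5 : ℤ) = q * (q - 1) * (q - 2) * (q - 3) * (q - 4) := by
    linear_combination 24 * h5 + (q - 4 : ℤ) * e4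
  simp only [sum_range_succ, sum_range_zero, newtonCoeffs, evalCoeffs, Nat.choose_zero_right,
    Nat.choose_one_right]
  push_cast
  linear_combination (-60 * d 2) * e2 - 20 * d 3 * e3 - 5 * d 4 * e4 - d 5 * e5

/-- The first six iterated differences of `f` at `r` with step `60`. -/
def sixtyDiffs (f : ℕ → ℤ) (r : ℕ) : ℕ → ℤ
  | 0 => f r
  | 1 => f (r + 60) - f r
  | 2 => f (r + 120) - 2 * f (r + 60) + f r
  | 3 => f (r + 180) - 3 * f (r + 120) + 3 * f (r + 60) - f r
  | 4 => f (r + 240) - 4 * f (r + 180) + 6 * f (r + 120) - 4 * f (r + 60) + f r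
  | _ => f (r + 300) - 5 * f (r + 240) + 10 * f (r + 180) - 10 * f (r + 120) + 5 * f (r + 60) - f r

lemma fwdDiff_iter_eq_sixtyDiffs (f : ℕ → ℤ) (r : ℕ) {j : ℕ} (hj : j < 6) :
    Δ_[60] ^[j] f r = sixtyDiffs f r j := by
  interval_cases j <;> simp [sixtyDiffs, fwdDiff, add_assoc] <;> ring

lemma evalCoeffs_boundedPartitions {r : ℕ} (hr : 0 < r) (q : ℕ) :
    evalCoeffs q (newtonCoeffs (sixtyDiffs (boundedPartitions 6) r)) =
      120 * boundedPartitions 6 (r + 60 * q) := by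
  have hd : ∀ i ∈ Icc 1 6, i ∣ 60 := by decide
  have h := shift_eq_sum_fwdDiff_iter 60 (boundedPartitions 6) q r
  rw [smul_eq_mul, mul_comm q 60] at h
  rw [evalCoeffs_newtonCoeffs, h]
  congr 1
  have h1 : ∑ j ∈ range (q + 1), q.choose j • Δ_[60] ^[j] (boundedPartitions 6) r =
      ∑ j ∈ range (q + 6), q.choose j • Δ_[60] ^[j] (boundedPartitions 6) r := by
    refine sum_subset (range_subset_range.2 (by omega)) fun j _ hj => ?_
    rw [Nat.choose_eq_zero_of_lt (by simpa using hj), zero_smul]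
  have h2 : ∑ j ∈ range 6, q.choose j • Δ_[60] ^[j] (boundedPartitions 6) r =
      ∑ j ∈ range (q + 6), q.choose j • Δ_[60] ^[j] (boundedPartitions 6) r := by
    refine sum_subset (range_subset_range.2 (by omega)) fun j _ hj => ?_
    obtain ⟨m, rfl⟩ := Nat.exists_eq_add_of_le (not_lt.1 (mt mem_range.2 hj))
    rw [fwdDiff_iter_boundedPartitions 6 hd m hr, smul_zero]
  rw [h1, ← h2]
  refine sum_congr rfl fun j hj => ?_
  rw [fwdDiff_iter_eq_sixtyDiffs _ _ (mem_range.1 hj), nsmul_eq_mul]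

/-! ### Numerical values -/

/-- The product `(X - 1) (X ^ 2 - 1) ⋯ (X ^ k - 1)` at `X = 2 ^ 32`. -/
def digitDenominator : ℕ → ℕ
  | 0 => 1
  | k + 1 => ((2 ^ 32) ^ (k + 1) - 1) * digitDenominator k

/-- The digit of index `n`, in base `X = 2 ^ 32`, of the fractional expansion of the generating
function `∏ i ∈ Icc 1 k, (1 - X⁻¹ ^ i)⁻¹` of the partitions into parts of size at most `k`. -/
def partitionDigit (k n : ℕ) : ℕ :=
  (2 ^ 32) ^ (n + k * (k + 1) / 2) / digitDenominator k % 2 ^ 32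

lemma partitionDigit_zero (n : ℕ) : partitionDigit 0 n = if n = 0 then 1 else 0 := by
  cases n with
  | zero => rfl
  | succ n => simp [partitionDigit, digitDenominator, pow_succ]

lemma partitionDigit_succ : ∀ k < 6, ∀ n < 441, partitionDigit (k + 1) n =
    partitionDigit k n + if n < k + 1 then 0 else partitionDigit (k + 1) (n - (k + 1)) := by
  decide +kernel

lemma partitionDigit_eq {k n : ℕ} (hk : k ≤ 6) (hn : n < 441) :
    (partitionDigit k n : ℤ) = boundedPartitions k n := by
  rw [boundedPartitions, Nat.cast_inj]
  induction k generalizing n with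
  | zero => simp [partitionDigit_zero, pA_zero_left]
  | succ k ih =>
    induction n using Nat.strong_induction_on with
    | h n ihn =>
      rw [partitionDigit_succ k hk n hn, ih (by omega) hn,
        pA_succ (a := fun i => i + 1) (fun i => i.succ_pos)]
      congr 1
      split_ifs with h
      · rw [pA_of_neg _ (by push_cast; omega)]
      · rw [ihn _ (by omega) (by omega), Nat.cast_sub (by omega)]

lemma sixtyDiffs_boundedPartitions {r : ℕ} (hr : r ≤ 140) :
    sixtyDiffs (boundedPartitions 6) r = sixtyDiffs (fun n => partitionDigit 6 n) r := by
  funext j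
  unfold sixtyDiffs
  split <;> simp (disch := omega) only [partitionDigit_eq]

/-! ### Log-concavity -/

/-- Coefficients of `p(r + 60 q)² - p(r - 1 + 60 q) p(r + 1 + 60 q)`, up to a constant factor, as
a polynomial in `q`, where `p` counts partitions into parts of size at most six; `r = s + 1`. -/
def logConcavityCoeffs (s : ℕ) : List ℤ :=
  let c := fun r => newtonCoeffs (sixtyDiffs (fun n => partitionDigit 6 n) r)
  addCoeffs (mulCoeffs (c (s + 1)) (c (s + 1))) (smulCoeffs (-1) (mulCoeffs (c (s + 2)) (c s)))

lemma logConcavityCoeffs_nonneg :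
    ∀ i < 60, 0 < (logConcavityCoeffs (79 + i)).headD 0 ∧
      ∀ x ∈ logConcavityCoeffs (79 + i), 0 ≤ x := by
  decide +kernel

theorem stmt13 :
    ∀ n : ℕ, 79 < n →
      pA (fun i => i + 1) 6 ((n : ℤ) + 1) * pA (fun i => i + 1) 6 ((n : ℤ) - 1) <
        pA (fun i => i + 1) 6 (n : ℤ) ^ 2 := by
  intro n hn
  obtain ⟨i, q, hi, rfl⟩ : ∃ i q, i < 60 ∧ n = 79 + i + 1 + 60 * q :=
    ⟨(n - 80) % 60, (n - 80) / 60, Nat.mod_lt _ (by norm_num), by omega⟩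
  obtain ⟨h0, hl⟩ := logConcavityCoeffs_nonneg i hi
  have h := evalCoeffs_pos (Int.natCast_nonneg q) h0 hl
  simp only [logConcavityCoeffs, evalCoeffs_add, evalCoeffs_smul, evalCoeffs_mul] at h
  rw [← sixtyDiffs_boundedPartitions (by omega), ← sixtyDiffs_boundedPartitions (by omega),
    ← sixtyDiffs_boundedPartitions (by omega), evalCoeffs_boundedPartitions (by omega),
    evalCoeffs_boundedPartitions (by omega), evalCoeffs_boundedPartitions (by omega)] at h
  have h' : boundedPartitions 6 (79 + i + 2 + 60 * q) * boundedPartitions 6 (79 + i + 60 * q) <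
      boundedPartitions 6 (79 + i + 1 + 60 * q) ^ 2 := by nlinarith
  simp only [boundedPartitions] at h'
  rw [show ((79 + i + 1 + 60 * q : ℕ) : ℤ) + 1 = (79 + i + 2 + 60 * q : ℕ) by push_cast; ring,
    show ((79 + i + 1 + 60 * q : ℕ) : ℤ) - 1 = (79 + i + 60 * q : ℕ) by push_cast; ring]
  exact_mod_cast h'
end

section
/- Let m ≥ 2 be an integer and let M = (m^{i−1})_{i≥1} be the sequence of consecutive powers of m. Then: (a) for every k ≥ 1 and all integers s ≥ 0 and 0 ≤ r ≤ m−1, p_M(sm + r, k) = p_M(sm, k); and (b) for every k ≥ 2 and every integer n ≥ 1, p_M(n,k)² < p_M(n+1,k)·p_M(n−1,k) if and only if n ≡ m−1 (mod m). In particular, for k ≥ 2 the sequence (p_M(n,k))_{n≥1} is not eventually log-concave. -/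
/-- The solution set counted by `pA` for consecutive powers of `m`. -/
def powerReps (m k : ℕ) (n : ℤ) : Set (Fin k → ℕ) :=
  {c | (∑ i, (c i : ℤ) * ((m ^ (i : ℕ) : ℕ) : ℤ)) = n}

theorem pA_pow_eq_ncard (m k : ℕ) (n : ℤ) :
    pA (fun i => m ^ i) k n = (powerReps m k n).ncard := rfl

theorem powerReps_finite {m : ℕ} (hm : 0 < m) (k : ℕ) (n : ℤ) : (powerReps m k n).Finite := by
  refine (Set.finite_Iic (fun _ : Fin k => n.toNat)).subset fun c hc i => ?_
  have h₁ : (c i : ℤ) * ((m ^ (i : ℕ) : ℕ) : ℤ) ≤ n :=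
    (Finset.single_le_sum (f := fun j : Fin k => (c j : ℤ) * ((m ^ (j : ℕ) : ℕ) : ℤ))
      (fun j _ => by positivity) (Finset.mem_univ i)).trans_eq hc
  have h₂ : (1 : ℤ) ≤ ((m ^ (i : ℕ) : ℕ) : ℤ) := by exact_mod_cast Nat.one_le_pow _ _ hm
  have h₃ : (c i : ℤ) ≤ n := by nlinarith [Int.natCast_nonneg (c i)]
  change c i ≤ n.toNat
  omega

theorem add_single_mem_powerReps {m k : ℕ} {n : ℤ} {c : Fin k → ℕ} (i : Fin k) (a : ℕ) :
    c + Pi.single i a ∈ powerReps m k (n + a * ((m ^ (i : ℕ) : ℕ) : ℤ)) ↔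
      c ∈ powerReps m k n := by
  have h : ∑ j, ((Pi.single i a : Fin k → ℕ) j : ℤ) * ((m ^ (j : ℕ) : ℕ) : ℤ) =
      a * ((m ^ (i : ℕ) : ℕ) : ℤ) := by
    rw [Finset.sum_eq_single i] <;> simp +contextual
  simp only [powerReps, Set.mem_ofPred_eq, Pi.add_apply, Nat.cast_add, add_mul,
    Finset.sum_add_distrib, h, add_left_inj]

theorem single_mem_powerReps {m k : ℕ} (i : Fin k) (a : ℕ) :
    Pi.single i a ∈ powerReps m k (a * ((m ^ (i : ℕ) : ℕ) : ℤ)) := by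
  have h : (0 : Fin k → ℕ) ∈ powerReps m k 0 := by simp [powerReps]
  simpa using (add_single_mem_powerReps i a).2 h

theorem image_add_single_zero_powerReps (m k : ℕ) (n : ℤ) :
    (· + Pi.single 0 1) '' powerReps m (k + 1) n = {c ∈ powerReps m (k + 1) (n + 1) | c 0 ≠ 0} := by
  have key (c : Fin (k + 1) → ℕ) :
      c + Pi.single 0 1 ∈ powerReps m (k + 1) (n + 1) ↔ c ∈ powerReps m (k + 1) n := by
    simpa using add_single_mem_powerReps (m := m) (n := n) (c := c) 0 1
  ext c
  constructor
  · rintro ⟨d, hd, rfl⟩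
    exact ⟨(key d).2 hd, by simp⟩
  · rintro ⟨hc, h0⟩
    have hle : (Pi.single 0 1 : Fin (k + 1) → ℕ) ≤ c := fun i => by
      obtain rfl | hi := eq_or_ne i 0
      · simpa using Nat.one_le_iff_ne_zero.2 h0
      · simp [hi]
    refine ⟨c - Pi.single 0 1, (key _).1 ?_, tsub_add_cancel_of_le hle⟩
    rwa [tsub_add_cancel_of_le hle]

theorem pA_pow_eq_ncard_sep (m k : ℕ) (n : ℤ) :
    pA (fun i => m ^ i) (k + 1) n = {c ∈ powerReps m (k + 1) (n + 1) | c 0 ≠ 0}.ncard := by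
  rw [← image_add_single_zero_powerReps, Set.ncard_image_of_injective _ (add_left_injective _),
    pA_pow_eq_ncard]

theorem pA_pow_le_succ {m : ℕ} (hm : 0 < m) (k : ℕ) (n : ℤ) :
    pA (fun i => m ^ i) (k + 1) n ≤ pA (fun i => m ^ i) (k + 1) (n + 1) := by
  rw [pA_pow_eq_ncard_sep]
  exact Set.ncard_le_ncard (Set.sep_subset _ _) (powerReps_finite hm _ _)

theorem pA_pow_succ_of_not_dvd {m : ℕ} (k : ℕ) {n : ℤ} (h : ¬ (m : ℤ) ∣ n + 1) :
    pA (fun i => m ^ i) (k + 1) (n + 1) = pA (fun i => m ^ i) (k + 1) n := by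
  rw [pA_pow_eq_ncard_sep m k n, pA_pow_eq_ncard]
  congr 1
  refine Set.Subset.antisymm (fun c hc => ⟨hc, fun h0 => h ?_⟩) (Set.sep_subset _ _)
  rw [← (hc : _ = n + 1), Fin.sum_univ_succ, h0]
  simp only [Nat.cast_zero, zero_mul, zero_add]
  refine Finset.dvd_sum fun i _ => Dvd.dvd.mul_left ?_ _
  exact_mod_cast dvd_pow_self m (by simp)

theorem pA_pow_lt_succ_of_dvd {m : ℕ} (hm : 0 < m) (k : ℕ) {n : ℕ} (h : m ∣ n + 1) :
    pA (fun i => m ^ i) (k + 2) (n : ℤ) < pA (fun i => m ^ i) (k + 2) ((n : ℤ) + 1) := by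
  rw [pA_pow_eq_ncard_sep]
  refine Set.ncard_lt_ncard ⟨Set.sep_subset _ _, fun hsub => ?_⟩ (powerReps_finite hm _ _)
  obtain ⟨s, hs⟩ := h
  have hmem : Pi.single 1 s ∈ powerReps m (k + 2) ((n : ℤ) + 1) := by
    have := single_mem_powerReps (m := m) (k := k + 2) 1 s
    rw [Fin.val_one, pow_one] at this
    rwa [show (n : ℤ) + 1 = s * m by exact_mod_cast hs.trans (mul_comm _ _)]
  exact (hsub hmem).2 (by simp)

theorem pA_pow_pos {m : ℕ} (hm : 0 < m) (k n : ℕ) :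
    0 < pA (fun i => m ^ i) (k + 1) (n : ℤ) := by
  rw [pA_pow_eq_ncard, Set.ncard_pos (powerReps_finite hm _ _)]
  exact ⟨Pi.single 0 n, by simpa using single_mem_powerReps (m := m) (k := k + 1) 0 n⟩

theorem pA_pow_mul_add (m k s r : ℕ) (hr : r < m) :
    pA (fun i => m ^ i) (k + 1) ((s * m + r : ℕ) : ℤ) =
      pA (fun i => m ^ i) (k + 1) ((s * m : ℕ) : ℤ) := by
  induction r with
  | zero => rfl
  | succ r ih =>
    rw [← ih (by omega), ← Nat.add_assoc, Nat.cast_succ]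
    refine pA_pow_succ_of_not_dvd k fun h => ?_
    have h' : m ∣ s * m + (r + 1) := by exact_mod_cast h
    exact Nat.not_dvd_of_pos_of_lt (Nat.succ_pos r) hr
      ((Nat.dvd_add_right (dvd_mul_left m s)).1 h')

theorem dvd_succ_iff_mod_eq {m : ℕ} (hm : 2 ≤ m) (n : ℕ) : m ∣ n + 1 ↔ n % m = m - 1 := by
  have hlt := Nat.mod_lt n (show 0 < m by omega)
  rw [Nat.dvd_iff_mod_eq_zero, Nat.add_mod, Nat.mod_eq_of_lt (show 1 < m by omega)]
  constructor
  · intro h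
    by_contra hne
    rw [Nat.mod_eq_of_lt (by omega)] at h
    omega
  · intro h
    rw [h, Nat.sub_add_cancel (by omega), Nat.mod_self]

theorem pA_pow_sq_lt_iff {m : ℕ} (hm : 2 ≤ m) (k n : ℕ) :
    pA (fun i => m ^ i) (k + 2) (n : ℤ) ^ 2 <
        pA (fun i => m ^ i) (k + 2) ((n : ℤ) + 1) * pA (fun i => m ^ i) (k + 2) ((n : ℤ) - 1) ↔
      n % m = m - 1 := by
  have hm0 : 0 < m := by omega
  rw [← dvd_succ_iff_mod_eq hm]
  constructor
  · contrapose!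
    intro h
    rw [pA_pow_succ_of_not_dvd (k + 1) (by exact_mod_cast h), sq]
    gcongr
    simpa using pA_pow_le_succ hm0 (k + 1) ((n : ℤ) - 1)
  · intro h
    have hn' : ¬ (m : ℤ) ∣ (n : ℤ) - 1 + 1 := by
      rw [sub_add_cancel, Int.natCast_dvd_natCast]
      intro hd
      have := Nat.le_of_dvd one_pos ((Nat.dvd_add_right hd).1 h)
      omega
    have heq := pA_pow_succ_of_not_dvd (k + 1) hn'
    rw [sub_add_cancel] at heq
    rw [← heq, sq]
    exact Nat.mul_lt_mul_of_pos_right (pA_pow_lt_succ_of_dvd hm0 k h) (pA_pow_pos hm0 (k + 1) n)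

theorem stmt14 (m : ℕ) (hm : 2 ≤ m) :
    (∀ k : ℕ, 1 ≤ k → ∀ s r : ℕ, r ≤ m - 1 →
      pA (fun i => m ^ i) k ((s * m + r : ℕ) : ℤ) = pA (fun i => m ^ i) k ((s * m : ℕ) : ℤ)) ∧
    (∀ k : ℕ, 2 ≤ k → ∀ n : ℕ, 1 ≤ n →
      (pA (fun i => m ^ i) k (n : ℤ) ^ 2 <
          pA (fun i => m ^ i) k ((n : ℤ) + 1) * pA (fun i => m ^ i) k ((n : ℤ) - 1) ↔
        n % m = m - 1)) ∧
    (∀ k : ℕ, 2 ≤ k → ∀ N : ℕ, ∃ n : ℕ, N ≤ n ∧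
      pA (fun i => m ^ i) k (n : ℤ) ^ 2 <
        pA (fun i => m ^ i) k ((n : ℤ) + 1) * pA (fun i => m ^ i) k ((n : ℤ) - 1)) := by
  refine ⟨fun k hk s r hr => ?_, fun k hk n hn => ?_, fun k hk N => ?_⟩
  · obtain ⟨k, rfl⟩ := Nat.exists_eq_add_of_le' hk
    exact pA_pow_mul_add m k s r (by omega)
  · obtain ⟨k, rfl⟩ := Nat.exists_eq_add_of_le' hk
    exact pA_pow_sq_lt_iff hm k n
  · obtain ⟨k, rfl⟩ := Nat.exists_eq_add_of_le' hk
    have hN : N ≤ m * N := Nat.le_mul_of_pos_left N (by omega)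
    refine ⟨m * N + (m - 1), by omega, (pA_pow_sq_lt_iff hm k _).2 ?_⟩
    rw [Nat.mul_add_mod, Nat.mod_eq_of_lt (by omega)]
end

section
/- Let A = (a_i)_{i≥1} be a non-decreasing sequence of positive integers and k ≥ 1 a fixed integer. Then there exists N such that p_A(a,k)·p_A(b,k) > p_A(a+b,k) holds for all integers a, b > N if and only if k ≥ 2 and gcd(a_1, a_2, …, a_k) = 1. -/
theorem finite_setOf_sum_mul_eq (a : ℕ → ℕ) (hpos : ∀ i, 0 < a i) (k : ℕ) (n : ℤ) :
    {c : Fin k → ℕ | (∑ i, (c i : ℤ) * (a i.val : ℤ)) = n}.Finite := by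
  refine (Set.finite_Iic (fun _ : Fin k => n.toNat)).subset fun c hc i => ?_
  have hle : (c i : ℤ) * (a i.val : ℤ) ≤ n := by
    rw [← show _ = n from hc]
    exact Finset.single_le_sum (f := fun i : Fin k => (c i : ℤ) * (a i.val : ℤ))
      (fun j _ => by positivity) (Finset.mem_univ i)
  have hai : (1 : ℤ) ≤ a i.val := by exact_mod_cast hpos i.val
  have : (c i : ℤ) ≤ n := by nlinarith [Int.natCast_nonneg (c i)]
  change c i ≤ n.toNat
  omega

theorem pA_pos_of_sum_eq (a : ℕ → ℕ) (hpos : ∀ i, 0 < a i) (k : ℕ) (n : ℤ) (c : Fin k → ℕ)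
    (hc : (∑ i, (c i : ℤ) * (a i.val : ℤ)) = n) : 0 < pA a k n :=
  (Set.ncard_pos (finite_setOf_sum_mul_eq a hpos k n)).2 ⟨c, hc⟩

theorem pA_succ_le (a : ℕ → ℕ) (hpos : ∀ i, 0 < a i) (K n : ℕ) :
    pA a (K + 1) n ≤ (n + 1) ^ K := by
  have hcard : ((Fintype.piFinset fun _ : Fin K => Finset.range (n + 1) :
      Finset (Fin K → ℕ)) : Set (Fin K → ℕ)).ncard = (n + 1) ^ K := by
    rw [Set.ncard_coe_finset]; simp
  rw [← hcard]
  refine Set.ncard_le_ncard_of_injOn Fin.tail ?_ ?_ (Finset.finite_toSet _)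
  · intro c hc
    simp only [Finset.mem_coe, Fintype.mem_piFinset, Finset.mem_range]
    intro i
    have hle : (c i.succ : ℤ) * (a i.succ.val : ℤ) ≤ n := by
      rw [← show _ = (n : ℤ) from hc]
      exact Finset.single_le_sum (f := fun i : Fin (K + 1) => (c i : ℤ) * (a i.val : ℤ))
        (fun j _ => by positivity) (Finset.mem_univ i.succ)
    have hai : (1 : ℤ) ≤ a i.succ.val := by exact_mod_cast hpos _
    have : (c i.succ : ℤ) ≤ n := by nlinarith [Int.natCast_nonneg (c i.succ)]
    change c i.succ < n + 1
    omega
  · intro c hc d hd h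
    have hi : ∀ i : Fin K, c i.succ = d i.succ := fun i => congrFun h i
    have hcd := (show _ = (n : ℤ) from hc).trans (show _ = (n : ℤ) from hd).symm
    rw [Fin.sum_univ_succ, Fin.sum_univ_succ] at hcd
    simp only [hi] at hcd
    have h0 : (a (0 : Fin (K + 1)).val : ℤ) ≠ 0 := by exact_mod_cast (hpos _).ne'
    have := mul_right_cancel₀ h0 (add_right_cancel hcd)
    funext i
    refine Fin.cases ?_ hi i
    exact_mod_cast this

theorem exists_forall_ge_exists_sum_mul_eq (a : ℕ → ℕ) (k : ℕ)
    (hgcd : (Finset.range k).gcd a = 1) :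
    ∃ F : ℕ, ∀ n ≥ F, ∃ c : Fin k → ℕ, ∑ i, c i * a i.val = n := by
  obtain ⟨F, hF⟩ := Nat.exists_mem_closure_of_ge (Set.range fun i : Fin k => a i.val)
  refine ⟨F, fun n hn => ?_⟩
  have hdvd : Nat.setGcd (Set.range fun i : Fin k => a i.val) ∣ n := by
    have : Nat.setGcd (Set.range fun i : Fin k => a i.val) ∣ 1 := by
      rw [← hgcd]
      refine Finset.dvd_gcd fun i hi => ?_
      exact Nat.setGcd_dvd_of_mem ⟨⟨i, Finset.mem_range.1 hi⟩, rfl⟩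
    exact this.trans (one_dvd n)
  have hmem := hF n hn hdvd
  clear hdvd hn
  induction hmem using AddSubmonoid.closure_induction with
  | mem x hx =>
    obtain ⟨i, rfl⟩ := hx
    exact ⟨Pi.single i 1, by simp [Pi.single_apply]⟩
  | zero => exact ⟨0, by simp⟩
  | add x y _ _ hx hy =>
    obtain ⟨c, rfl⟩ := hx
    obtain ⟨d, rfl⟩ := hy
    exact ⟨c + d, by simp [add_mul, Finset.sum_add_distrib]⟩

theorem le_pA_of_sum_eq (a : ℕ → ℕ) (hpos : ∀ i, 0 < a i) (K L s r : ℕ) (hL : 0 < L)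
    (hdvd : ∀ i : Fin (K + 1), a i.val ∣ L) (e : Fin (K + 1) → ℕ)
    (he : ∑ i, e i * a i.val = r) :
    (s + 1) ^ K ≤ pA a (K + 1) ((r + L * (K * s) : ℕ) : ℤ) := by
  have hcard : ((Fintype.piFinset fun _ : Fin K => Finset.range (s + 1) :
      Finset (Fin K → ℕ)) : Set (Fin K → ℕ)).ncard = (s + 1) ^ K := by
    rw [Set.ncard_coe_finset]; simp
  rw [← hcard]
  let t : (Fin K → ℕ) → Fin (K + 1) → ℕ := fun u => Fin.cons (K * s - ∑ i, u i) u
  refine Set.ncard_le_ncard_of_injOn (fun u i => e i + t u i * (L / a i.val)) ?_ ?_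
    (finite_setOf_sum_mul_eq a hpos _ _)
  · intro u hu
    simp only [Finset.mem_coe, Fintype.mem_piFinset, Finset.mem_range] at hu
    have hsum : ∑ i, u i ≤ K * s := by
      simpa using Finset.sum_le_card_nsmul Finset.univ u s fun i _ => Nat.lt_succ_iff.1 (hu i)
    have ht : ∑ i, t u i = K * s := by
      simp only [t, Fin.sum_univ_succ, Fin.cons_zero, Fin.cons_succ]
      omega
    have key : ∑ i, (e i + t u i * (L / a i.val)) * a i.val = r + L * (K * s) := by
      rw [← he, ← ht, Finset.mul_sum, ← Finset.sum_add_distrib]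
      refine Finset.sum_congr rfl fun i _ => ?_
      rw [add_mul, mul_assoc, Nat.div_mul_cancel (hdvd i), mul_comm L]
    change _ = _
    rw [← key]
    push_cast
    rfl
  · intro u _ v _ h
    funext i
    have hi := congrFun h i.succ
    simp only [t, Fin.cons_succ] at hi
    exact Nat.eq_of_mul_eq_mul_right
      (Nat.div_pos (Nat.le_of_dvd hL (hdvd i.succ)) (hpos _)) (Nat.add_left_cancel hi)

theorem exists_pow_le_mul_pA (a : ℕ → ℕ) (hpos : ∀ i, 0 < a i) (K : ℕ)
    (hgcd : (Finset.range (K + 1)).gcd a = 1) :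
    ∃ D M : ℕ, 0 < D ∧ ∀ n ≥ M, n ^ K ≤ D ^ K * pA a (K + 1) (n : ℤ) := by
  obtain ⟨F, hF⟩ := exists_forall_ge_exists_sum_mul_eq a (K + 1) hgcd
  let L := ∏ i : Fin (K + 1), a i.val
  have hL : 0 < L := Finset.prod_pos fun i _ => hpos _
  have hdvd : ∀ i : Fin (K + 1), a i.val ∣ L := fun i =>
    Finset.dvd_prod_of_mem (fun i : Fin (K + 1) => a i.val) (Finset.mem_univ i)
  refine ⟨2 * (L * (K + 1)), 2 * F, by positivity, fun n hn => ?_⟩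
  let s := (n - F) / (L * (K + 1))
  have hs : L * (K + 1) * s ≤ n - F := Nat.mul_div_le _ _
  have hs' : n - F < L * (K + 1) * (s + 1) := Nat.lt_mul_div_succ _ (by positivity)
  have hle : L * (K * s) ≤ L * (K + 1) * s := by
    rw [← mul_assoc]
    gcongr
    omega
  obtain ⟨e, he⟩ := hF (n - L * (K * s)) (by omega)
  have := le_pA_of_sum_eq a hpos K L s _ hL hdvd e he
  rw [Nat.sub_add_cancel (by omega)] at this
  calc n ^ K ≤ (2 * (L * (K + 1)) * (s + 1)) ^ K := by
        gcongr
        rw [mul_assoc]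
        omega
    _ = (2 * (L * (K + 1))) ^ K * (s + 1) ^ K := mul_pow _ _ _
    _ ≤ _ := by gcongr

theorem exists_forall_pA_add_lt_mul (a : ℕ → ℕ) (hpos : ∀ i, 0 < a i) (K : ℕ) (hK : K ≠ 0)
    (hgcd : (Finset.range (K + 1)).gcd a = 1) :
    ∃ N : ℕ, ∀ m n : ℕ, N < m → N < n →
      pA a (K + 1) ((m + n : ℕ) : ℤ) < pA a (K + 1) m * pA a (K + 1) n := by
  obtain ⟨D, M, hD, hlow⟩ := exists_pow_le_mul_pA a hpos K hgcd
  refine ⟨3 * D ^ 2 + M, fun m n hm hn => ?_⟩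
  have hlt : D ^ 2 * (m + n + 1) < m * n := by
    rcases le_total m n with h | h
    · calc D ^ 2 * (m + n + 1) ≤ D ^ 2 * (3 * n) := by gcongr; omega
        _ = (3 * D ^ 2) * n := by ring
        _ < m * n := by gcongr <;> omega
    · calc D ^ 2 * (m + n + 1) ≤ D ^ 2 * (3 * m) := by gcongr; omega
        _ = (3 * D ^ 2) * m := by ring
        _ < n * m := by gcongr <;> omega
        _ = m * n := mul_comm _ _
  refine (pA_succ_le a hpos K (m + n)).trans_lt ?_
  refine lt_of_mul_lt_mul_left (a := (D ^ 2) ^ K) ?_ (Nat.zero_le _)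
  calc (D ^ 2) ^ K * (m + n + 1) ^ K = (D ^ 2 * (m + n + 1)) ^ K := (mul_pow _ _ _).symm
    _ < (m * n) ^ K := Nat.pow_lt_pow_left hlt hK
    _ = m ^ K * n ^ K := mul_pow _ _ _
    _ ≤ (D ^ K * pA a (K + 1) m) * (D ^ K * pA a (K + 1) n) :=
        Nat.mul_le_mul (hlow m (by omega)) (hlow n (by omega))
    _ = (D ^ 2) ^ K * (pA a (K + 1) m * pA a (K + 1) n) := by ring

theorem pA_eq_zero_of_not_dvd (a : ℕ → ℕ) (k : ℕ) (n : ℤ)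
    (h : ¬ (((Finset.range k).gcd a : ℕ) : ℤ) ∣ n) : pA a k n = 0 := by
  have : {c : Fin k → ℕ | (∑ i, (c i : ℤ) * (a i.val : ℤ)) = n} = ∅ := by
    refine Set.eq_empty_of_forall_notMem fun c hc => h ?_
    rw [← show _ = n from hc]
    refine Finset.dvd_sum fun i _ => Dvd.dvd.mul_left ?_ _
    exact_mod_cast Finset.gcd_dvd (Finset.mem_range.2 i.isLt)
  rw [pA, this, Set.ncard_empty]

theorem stmt17 (a : ℕ → ℕ) (hpos : ∀ i, 0 < a i) (hmono : Monotone a)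
    (k : ℕ) (hk : 1 ≤ k) :
    (∃ N : ℤ, ∀ m n : ℤ, N < m → N < n → pA a k (m + n) < pA a k m * pA a k n) ↔
      (2 ≤ k ∧ (Finset.range k).gcd a = 1) := by
  constructor
  · rintro ⟨N, hN⟩
    constructor
    · by_contra hk2
      obtain rfl : k = 1 := by omega
      let m : ℕ := (N.natAbs + 1) * a 0
      have hm : N < m := by
        have : N.natAbs + 1 ≤ m := Nat.le_mul_of_pos_right _ (hpos 0)
        omega
      have hlt := hN m m hm hm
      have hle : pA a 1 m ≤ 1 := by simpa using pA_succ_le a hpos 0 m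
      have hp : 0 < pA a 1 ((m : ℤ) + m) :=
        pA_pos_of_sum_eq a hpos 1 _ (fun _ => 2 * (N.natAbs + 1)) (by
          simp [m]; ring)
      have := Nat.mul_le_mul hle hle
      omega
    · by_contra hd
      let d := (Finset.range k).gcd a
      have hd0 : d ≠ 0 := fun h =>
        (hpos 0).ne' (Finset.gcd_eq_zero_iff.1 h 0 (Finset.mem_range.2 hk))
      let m : ℕ := d * N.natAbs + 1
      have hm : N < m := by
        have : N.natAbs ≤ d * N.natAbs := Nat.le_mul_of_pos_left _ (Nat.pos_of_ne_zero hd0)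
        omega
      have hz : pA a k m = 0 := by
        refine pA_eq_zero_of_not_dvd a k m fun h => hd ?_
        have h' : d ∣ d * N.natAbs + 1 := Int.natCast_dvd_natCast.1 h
        exact Nat.dvd_one.1 ((Nat.dvd_add_right (dvd_mul_right _ _)).1 h')
      have := hN m m hm hm
      simp [hz] at this
  · rintro ⟨hk2, hgcd⟩
    obtain ⟨K, rfl⟩ : ∃ K, k = K + 1 := ⟨k - 1, by omega⟩
    obtain ⟨N, hN⟩ := exists_forall_pA_add_lt_mul a hpos K (by omega) hgcd
    refine ⟨N, fun m n hm hn => ?_⟩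
    lift m to ℕ using by omega
    lift n to ℕ using by omega
    exact_mod_cast hN m n (by omega) (by omega)
end

section
/- Let A = (a_i)_{i≥1} be a non-decreasing sequence of positive integers and k ≥ 1 a fixed integer. Then there exists N such that p_A(n,k)² > p_A(n+1,k)·p_A(n−1,k) for all integers n > N if and only if either (k ≥ 2 and a_1 = a_2 = ⋯ = a_k = 1) or (k ≥ 4 and gcd(a_{i_1}, …, a_{i_{k−2}}) = 1 for every choice of k−2 indices 1 ≤ i_1 < ⋯ < i_{k−2} ≤ k). -/
open Filter Topology PowerSeries

/-- The sequence `u` is asymptotically `c * n ^ m`, in the sense that `u n / n ^ m` tends to `c`. -/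
def HasGrowth (u : ℕ → ℝ) (m : ℕ) (c : ℝ) : Prop :=
  Tendsto (fun n : ℕ => u n / (n : ℝ) ^ m) atTop (𝓝 c)

namespace HasGrowth

variable {u v : ℕ → ℝ} {m : ℕ} {b c : ℝ}

theorem congr' (h : HasGrowth u m c) (huv : u =ᶠ[atTop] v) : HasGrowth v m c :=
  Tendsto.congr' (by filter_upwards [huv] with n hn; rw [hn]) h

theorem add (hu : HasGrowth u m b) (hv : HasGrowth v m c) :
    HasGrowth (fun n => u n + v n) m (b + c) :=
  (Tendsto.add hu hv).congr fun n => by ring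

theorem sub (hu : HasGrowth u m b) (hv : HasGrowth v m c) :
    HasGrowth (fun n => u n - v n) m (b - c) :=
  (Tendsto.sub hu hv).congr fun n => by ring

theorem const_mul (hu : HasGrowth u m c) (b : ℝ) : HasGrowth (fun n => b * u n) m (b * c) :=
  (Tendsto.const_mul b hu).congr fun n => by ring

theorem mul {l : ℕ} (hu : HasGrowth u m b) (hv : HasGrowth v l c) :
    HasGrowth (fun n => u n * v n) (m + l) (b * c) :=
  (Tendsto.mul hu hv).congr fun n => by rw [pow_add, div_mul_div_comm]

theorem div {l : ℕ} (hu : HasGrowth u (m + l) b) (hv : HasGrowth v l c) (hc : c ≠ 0) :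
    HasGrowth (fun n => u n / v n) m (b / c) := by
  refine (Tendsto.div hu hv hc).congr' ?_
  filter_upwards [eventually_gt_atTop 0] with n hn
  have : (n : ℝ) ≠ 0 := by positivity
  simp only [Pi.div_apply]
  rw [pow_add]
  by_cases h : v n = 0
  · simp [h]
  · field_simp

theorem pow_self (m : ℕ) (c : ℝ) : HasGrowth (fun n => c * (n : ℝ) ^ m) m c := by
  refine tendsto_const_nhds.congr' ?_
  filter_upwards [eventually_gt_atTop 0] with n hn
  have : (n : ℝ) ≠ 0 := by positivity
  field_simp

theorem le (hu : HasGrowth u m b) (hv : HasGrowth v m c) (h : ∀ᶠ n in atTop, u n ≤ v n) :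
    b ≤ c :=
  le_of_tendsto_of_tendsto hu hv (by
    filter_upwards [h] with n hn
    gcongr)

theorem squeeze {w : ℕ → ℝ} (hu : HasGrowth u m c) (hw : HasGrowth w m c)
    (h₁ : ∀ᶠ n in atTop, u n ≤ v n) (h₂ : ∀ᶠ n in atTop, v n ≤ w n) : HasGrowth v m c :=
  tendsto_of_tendsto_of_tendsto_of_le_of_le' hu hw
    (by filter_upwards [h₁] with n hn; gcongr) (by filter_upwards [h₂] with n hn; gcongr)

theorem eventually_le (hu : HasGrowth u m b) (hbc : b < c) :
    ∀ᶠ n in atTop, u n ≤ c * (n : ℝ) ^ m := by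
  filter_upwards [Tendsto.eventually_lt_const hbc hu, eventually_gt_atTop 0] with n hn hn0
  have : (0 : ℝ) < (n : ℝ) ^ m := by positivity
  exact ((div_lt_iff₀ this).1 hn).le

theorem eventually_pos (hu : HasGrowth u m c) (hc : 0 < c) : ∀ᶠ n in atTop, 0 < u n := by
  filter_upwards [Tendsto.eventually_const_lt hc hu, eventually_gt_atTop 0] with n hn hn0
  have : (0 : ℝ) < (n : ℝ) ^ m := by positivity
  exact (div_pos_iff_of_pos_right this).1 hn

theorem shift_iff (d : ℕ) : HasGrowth (fun n => u (n + d)) m c ↔ HasGrowth u m c := by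
  have key : Tendsto (fun n : ℕ => ((n : ℝ) / (n + d : ℝ)) ^ m) atTop (𝓝 1) := by
    simpa using (tendsto_natCast_div_add_atTop (d : ℝ)).pow m
  have key' : Tendsto (fun n : ℕ => (((n : ℝ) / (n + d : ℝ)) ^ m)⁻¹) atTop (𝓝 1) := by
    simpa using key.inv₀ one_ne_zero
  constructor
  · intro h
    refine (tendsto_add_atTop_iff_nat d).1 ?_
    have := Tendsto.mul h key
    rw [mul_one] at this
    refine this.congr' ?_
    filter_upwards [eventually_gt_atTop 0] with n hn
    have : (n : ℝ) ≠ 0 := by positivity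
    have : (n : ℝ) + d ≠ 0 := by positivity
    push_cast
    rw [div_pow]
    field_simp
  · intro h
    have := Tendsto.mul ((tendsto_add_atTop_iff_nat d).2 h) key'
    rw [mul_one] at this
    refine this.congr' ?_
    filter_upwards [eventually_gt_atTop 0] with n hn
    have : (n : ℝ) ≠ 0 := by positivity
    have : (n : ℝ) + d ≠ 0 := by positivity
    push_cast
    rw [div_pow]
    field_simp

theorem shift_back (d : ℕ) (h : HasGrowth u m c) : HasGrowth (fun n => u (n - d)) m c := by
  rw [← shift_iff d]
  simpa using h

theorem pow_succ_sub_pow (m : ℕ) :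
    HasGrowth (fun n => ((n : ℝ) + 1) ^ (m + 1) - (n : ℝ) ^ (m + 1)) m (m + 1) := by
  have hterm (j : ℕ) (hj : j ∈ Finset.range (m + 1)) :
      HasGrowth (fun n => ((n : ℝ) + 1) ^ j * (n : ℝ) ^ (m + 1 - 1 - j)) m 1 := by
    have h₁ : HasGrowth (fun n => ((n : ℝ) + 1) ^ j) j 1 := by
      simpa using (shift_iff 1).2 (pow_self j 1)
    have h₂ : HasGrowth (fun n => (n : ℝ) ^ (m + 1 - 1 - j)) (m - j) 1 := by
      simpa using pow_self (m - j) 1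
    have := h₁.mul h₂
    rwa [mul_one, Nat.add_sub_cancel' (by simpa [Nat.lt_succ_iff] using hj)] at this
  have := tendsto_finsetSum (Finset.range (m + 1)) hterm
  simp only [Finset.sum_const, Finset.card_range, nsmul_eq_mul, mul_one] at this
  push_cast at this
  refine this.congr fun n => ?_
  rw [← Finset.sum_div]
  congr 1
  simpa using (Commute.all ((n : ℝ) + 1) n).geom_sum₂_mul (m + 1)

theorem sum_range (hu : HasGrowth u m c) :
    HasGrowth (fun n => ∑ i ∈ Finset.range n, u i) (m + 1) (c / (m + 1)) := by
  set h : ℕ → ℝ := fun n => ((n : ℝ) + 1) ^ (m + 1) - (n : ℝ) ^ (m + 1) with h_def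
  have hpos (n : ℕ) : 0 < h n := by
    have : (n : ℝ) ^ (m + 1) < ((n : ℝ) + 1) ^ (m + 1) := by gcongr; linarith
    exact sub_pos.2 this
  have hsum (n : ℕ) : ∑ i ∈ Finset.range n, h i = (n : ℝ) ^ (m + 1) := by
    have := Finset.sum_range_sub (fun i : ℕ => (i : ℝ) ^ (m + 1)) n
    simpa [h_def] using this
  have hm : (m + 1 : ℝ) ≠ 0 := by positivity
  have hlim : HasGrowth (fun n => u n / h n) 0 (c / (m + 1)) :=
    div (by simpa using hu) (pow_succ_sub_pow m) hm
  have hlim' : Tendsto (fun n => u n / h n - c / (m + 1)) atTop (𝓝 0) := by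
    have : Tendsto (fun n => u n / h n) atTop (𝓝 (c / (m + 1))) := by
      simpa [HasGrowth] using hlim
    simpa using this.sub_const (c / (m + 1))
  have ho : (fun n => u n - c / (m + 1) * h n) =o[atTop] h := by
    refine (Asymptotics.isLittleO_iff_tendsto fun n hn => absurd hn (hpos n).ne').2 ?_
    refine hlim'.congr fun n => ?_
    have := (hpos n).ne'
    field_simp
  have hS := ho.sum_range (fun n => (hpos n).le) (by
    simp only [hsum]
    exact (tendsto_pow_atTop (Nat.succ_ne_zero m)).comp tendsto_natCast_atTop_atTop)
  have hS' := hS.tendsto_div_nhds_zero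
  simp only [Finset.sum_sub_distrib, ← Finset.mul_sum, hsum] at hS'
  have := hS'.add_const (c / (m + 1))
  rw [zero_add] at this
  refine this.congr' ?_
  filter_upwards [eventually_gt_atTop 0] with n hn
  have : (n : ℝ) ≠ 0 := by positivity
  field_simp
  ring

end HasGrowth

/-- The sequence of coefficients of `f` is asymptotically `c * n ^ m`. -/
abbrev CoeffGrowth (f : ℝ⟦X⟧) (m : ℕ) (c : ℝ) : Prop := HasGrowth (fun n => coeff n f) m c

theorem coeff_polynomial_mul (Q : Polynomial ℝ) (f : ℝ⟦X⟧) {n : ℕ} (hn : Q.natDegree ≤ n) :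
    coeff n ((Q : ℝ⟦X⟧) * f) =
      ∑ j ∈ Finset.range (Q.natDegree + 1), Q.coeff j * coeff (n - j) f := by
  conv_lhs => rw [Q.as_sum_range_C_mul_X_pow]
  rw [← Polynomial.coeToPowerSeries.ringHom_apply, map_sum, Finset.sum_mul, map_sum]
  refine Finset.sum_congr rfl fun j hj => ?_
  have hjn : j ≤ n := (Nat.lt_succ_iff.1 (Finset.mem_range.1 hj)).trans hn
  simp [mul_assoc, coeff_C_mul, coeff_X_pow_mul', hjn]

theorem eval_one_eq_sum (Q : Polynomial ℝ) :
    Q.eval 1 = ∑ j ∈ Finset.range (Q.natDegree + 1), Q.coeff j := by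
  simp [Polynomial.eval_eq_sum_range]

theorem CoeffGrowth.X_mul {f : ℝ⟦X⟧} {m : ℕ} {c : ℝ} (h : CoeffGrowth f m c) :
    CoeffGrowth (X * f) m c := by
  unfold CoeffGrowth
  rw [← HasGrowth.shift_iff 1]
  simpa [coeff_succ_X_mul] using h

theorem CoeffGrowth.polynomial_mul {f : ℝ⟦X⟧} {m : ℕ} {c : ℝ} (h : CoeffGrowth f m c)
    (Q : Polynomial ℝ) : CoeffGrowth ((Q : ℝ⟦X⟧) * f) m (Q.eval 1 * c) := by
  induction Q using Polynomial.induction_on' with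
  | add p q hp hq =>
    simpa [CoeffGrowth, add_mul] using HasGrowth.add hp hq
  | monomial n a =>
    have hX : CoeffGrowth (X ^ n * f) m c := by
      induction n with
      | zero => simpa using h
      | succ n ih => rw [pow_succ', mul_assoc]; exact ih.X_mul
    simpa [CoeffGrowth, ← Polynomial.C_mul_X_pow_eq_monomial, mul_assoc, coeff_C_mul]
      using HasGrowth.const_mul hX a

theorem coeff_X_mul_eq_sum (f : ℝ⟦X⟧) (n : ℕ) :
    coeff n (X * f) = ∑ i ∈ Finset.range n, coeff i ((1 - X) * f) := by
  induction n with
  | zero => simp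
  | succ n ih =>
    rw [Finset.sum_range_succ, ← ih, coeff_succ_X_mul, sub_mul, one_mul, map_sub]
    ring

theorem CoeffGrowth.of_one_sub_X_mul {f : ℝ⟦X⟧} {m : ℕ} {c : ℝ}
    (h : CoeffGrowth ((1 - X) * f) m c) : CoeffGrowth f (m + 1) (c / (m + 1)) := by
  have h₁ := HasGrowth.sum_range h
  simp only [← coeff_X_mul_eq_sum] at h₁
  have := (HasGrowth.shift_iff 1).2 h₁
  simpa [coeff_succ_X_mul] using this

theorem CoeffGrowth.eventually_le_polynomial_mul {f g : ℝ⟦X⟧} {Q : Polynomial ℝ}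
    (hQ : ∀ j, 0 ≤ Q.coeff j) (h : ∀ᶠ n in atTop, coeff n f ≤ coeff n g) :
    ∀ᶠ n in atTop, coeff n ((Q : ℝ⟦X⟧) * f) ≤ coeff n ((Q : ℝ⟦X⟧) * g) := by
  obtain ⟨N, hN⟩ := eventually_atTop.1 h
  filter_upwards [eventually_ge_atTop (N + Q.natDegree)] with n hn
  rw [coeff_polynomial_mul _ _ (by lia), coeff_polynomial_mul _ _ (by lia)]
  refine Finset.sum_le_sum fun j hj => mul_le_mul_of_nonneg_left (hN _ ?_) (hQ j)
  have := Finset.mem_range.1 hj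
  lia

/-- The polynomial `1 + X + ⋯ + X ^ (d - 1)`. -/
noncomputable def windowPoly (d : ℕ) : Polynomial ℝ := ∑ j ∈ Finset.range d, Polynomial.X ^ j

theorem windowPoly_coeff_nonneg (d j : ℕ) : 0 ≤ (windowPoly d).coeff j := by
  rw [windowPoly, Polynomial.finsetSum_coeff]
  refine Finset.sum_nonneg fun i _ => ?_
  rw [Polynomial.coeff_X_pow]
  split_ifs <;> simp

@[simp]
theorem windowPoly_eval_one (d : ℕ) : (windowPoly d).eval 1 = d := by
  simp [windowPoly, Polynomial.eval_finsetSum]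

theorem one_sub_X_mul_windowPoly (d : ℕ) :
    (1 - X) * (windowPoly d : ℝ⟦X⟧) = 1 - X ^ d := by
  have h : (1 - Polynomial.X) * windowPoly d = 1 - Polynomial.X ^ d := by
    rw [windowPoly, mul_neg_geom_sum]
  simpa using congrArg (fun p : Polynomial ℝ => (p : ℝ⟦X⟧)) h

theorem coeff_mul_nonneg {f g : ℝ⟦X⟧} (hf : ∀ n, 0 ≤ coeff n f) (hg : ∀ n, 0 ≤ coeff n g)
    (n : ℕ) : 0 ≤ coeff n (f * g) := by
  rw [coeff_mul]
  exact Finset.sum_nonneg fun i _ => mul_nonneg (hf _) (hg _)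

theorem CoeffGrowth.of_eventually_monotone {f : ℝ⟦X⟧} {m : ℕ} {c : ℝ} {Q : Polynomial ℝ}
    (hQ : ∀ j, 0 ≤ Q.coeff j) (hQ1 : 0 < Q.eval 1)
    (hf : ∀ᶠ n in atTop, coeff n f ≤ coeff (n + 1) f)
    (h : CoeffGrowth ((Q : ℝ⟦X⟧) * f) m c) : CoeffGrowth f m (c / Q.eval 1) := by
  obtain ⟨N, hN⟩ := eventually_atTop.1 hf
  have hmono : ∀ i j, N ≤ i → i ≤ j → coeff i f ≤ coeff j f := fun i j hi hij =>
    Nat.le_induction le_rfl (fun k hk ih => ih.trans (hN k (hi.trans hk))) j hij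
  have h' : CoeffGrowth ((Q : ℝ⟦X⟧) * f) m c := h
  have hlow := HasGrowth.const_mul h' (Q.eval 1)⁻¹
  have hup := HasGrowth.const_mul ((HasGrowth.shift_iff Q.natDegree).2 h') (Q.eval 1)⁻¹
  rw [div_eq_inv_mul]
  refine HasGrowth.squeeze hlow hup ?_ ?_
  · filter_upwards [eventually_ge_atTop (N + Q.natDegree)] with n hn
    rw [inv_mul_le_iff₀ hQ1, coeff_polynomial_mul _ _ (by lia), eval_one_eq_sum, Finset.sum_mul]
    refine Finset.sum_le_sum fun j hj => mul_le_mul_of_nonneg_left (hmono _ _ ?_ ?_) (hQ j)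
    all_goals have := Finset.mem_range.1 hj; lia
  · filter_upwards [eventually_ge_atTop N] with n hn
    rw [le_inv_mul_iff₀ hQ1, coeff_polynomial_mul _ _ (by lia), eval_one_eq_sum, Finset.sum_mul]
    refine Finset.sum_le_sum fun j hj => mul_le_mul_of_nonneg_left (hmono _ _ ?_ ?_) (hQ j)
    all_goals have := Finset.mem_range.1 hj; lia

/-- The power series `∑ j, X ^ (e * j)`. -/
noncomputable def geomSeries (e : ℕ) : ℝ⟦X⟧ := mk fun n => if e ∣ n then 1 else 0

theorem one_sub_X_pow_mul_geomSeries {e : ℕ} (he : 0 < e) :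
    (1 - X ^ e) * geomSeries e = 1 := by
  ext n
  rw [sub_mul, one_mul, map_sub, coeff_X_pow_mul', geomSeries, coeff_mk, coeff_mk, coeff_one]
  by_cases hn : e ≤ n
  · have h0 : n ≠ 0 := by lia
    have : e ∣ n - e ↔ e ∣ n := by
      rw [Nat.dvd_sub_iff_left hn dvd_rfl]
    simp [hn, h0, this]
  · by_cases h0 : n = 0
    · simp [h0, he.ne']
    · have : ¬ e ∣ n := fun h => hn (Nat.le_of_dvd (by lia) h)
      simp [hn, h0, this]

/-- The generating function of partitions into the parts `a i`, `i ∈ s`. -/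
noncomputable def partSeries (a : ℕ → ℕ) (s : Finset ℕ) : ℝ⟦X⟧ := ∏ i ∈ s, geomSeries (a i)

section partSeries

variable {a : ℕ → ℕ} {s : Finset ℕ}

theorem geomSeries_coeff_nonneg (e n : ℕ) : 0 ≤ coeff n (geomSeries e) := by
  rw [geomSeries, coeff_mk]
  split_ifs <;> simp

theorem partSeries_coeff_nonneg (a : ℕ → ℕ) (s : Finset ℕ) (n : ℕ) :
    0 ≤ coeff n (partSeries a s) := by
  induction s using Finset.induction_on generalizing n with
  | empty => simp only [partSeries, Finset.prod_empty, coeff_one]; split_ifs <;> simp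
  | insert i s hi ih =>
    rw [partSeries, Finset.prod_insert hi]
    exact coeff_mul_nonneg (geomSeries_coeff_nonneg _) ih n

theorem one_sub_X_pow_mul_partSeries (hpos : ∀ i, 0 < a i) {i : ℕ} (hi : i ∈ s) :
    (1 - X ^ a i) * partSeries a s = partSeries a (s.erase i) := by
  rw [partSeries, ← Finset.mul_prod_erase _ _ hi, ← mul_assoc,
    one_sub_X_pow_mul_geomSeries (hpos i), one_mul, partSeries]

/-- The leading coefficient `1 / (m! ∏ a i)`. -/
noncomputable def leadCoeff (a : ℕ → ℕ) (s : Finset ℕ) (m : ℕ) : ℝ :=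
  1 / ((m.factorial : ℝ) * ∏ i ∈ s, (a i : ℝ))

theorem leadCoeff_pos (hpos : ∀ i, 0 < a i) (s : Finset ℕ) (m : ℕ) : 0 < leadCoeff a s m := by
  have : 0 < ∏ i ∈ s, (a i : ℝ) := Finset.prod_pos fun i _ => by exact_mod_cast hpos i
  have : (0 : ℝ) < m.factorial := by exact_mod_cast m.factorial_pos
  unfold leadCoeff
  positivity

theorem leadCoeff_erase (hpos : ∀ i, 0 < a i) {i : ℕ} (hi : i ∈ s) (m : ℕ) :
    leadCoeff a (s.erase i) m = a i * leadCoeff a s m := by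
  have h := Finset.mul_prod_erase s (fun i => (a i : ℝ)) hi
  have : (a i : ℝ) ≠ 0 := by exact_mod_cast (hpos i).ne'
  rw [leadCoeff, leadCoeff, ← h]
  field_simp

theorem leadCoeff_succ (m : ℕ) : leadCoeff a s m = (m + 1) * leadCoeff a s (m + 1) := by
  rw [leadCoeff, leadCoeff, Nat.factorial_succ]
  push_cast
  field_simp

theorem growth_geomSeries_one_mul_partSeries (hpos : ∀ i, 0 < a i) (s : Finset ℕ) :
    CoeffGrowth (geomSeries 1 * partSeries a s) s.card (leadCoeff a s s.card) := by
  have hN (s : Finset ℕ) : (1 - X) * (geomSeries 1 * partSeries a s) = partSeries a s := by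
    rw [← mul_assoc, ← one_mul (partSeries a s)]
    simpa using congrArg (· * partSeries a s) (one_sub_X_pow_mul_geomSeries one_pos)
  induction s using Finset.induction_on with
  | empty => simpa [leadCoeff, partSeries, geomSeries, CoeffGrowth] using HasGrowth.pow_self 0 1
  | insert i s hi ih =>
    have hi' := Finset.mem_insert_self i s
    have herase := Finset.erase_insert hi
    have h₁ : (1 - X) * ((windowPoly (a i) : ℝ⟦X⟧) *
        (geomSeries 1 * partSeries a (insert i s))) = geomSeries 1 * partSeries a s := by
      rw [← mul_assoc, one_sub_X_mul_windowPoly, mul_left_comm,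
        one_sub_X_pow_mul_partSeries hpos hi', herase]
    rw [← h₁] at ih
    have h₂ := ih.of_one_sub_X_mul
    have h₃ := h₂.of_eventually_monotone (windowPoly_coeff_nonneg _)
      (by simpa using hpos i) (Eventually.of_forall fun n => ?_)
    · rw [Finset.card_insert_of_notMem hi]
      convert h₃ using 1
      have h₄ := leadCoeff_erase hpos hi' s.card
      rw [herase, leadCoeff_succ (s := insert i s)] at h₄
      have : (a i : ℝ) ≠ 0 := by exact_mod_cast (hpos i).ne'
      rw [windowPoly_eval_one, h₄]
      field_simp
    · have := partSeries_coeff_nonneg a (insert i s) (n + 1)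
      rw [← hN (insert i s), sub_mul, one_mul, map_sub, coeff_succ_X_mul] at this
      linarith

theorem growth_windowPoly_mul_partSeries (hpos : ∀ i, 0 < a i) {i : ℕ} (hi : i ∈ s) {m : ℕ}
    (hm : s.card = m + 1) {d : ℕ} (hd : a i ∣ d) :
    CoeffGrowth ((windowPoly d : ℝ⟦X⟧) * partSeries a s) m (d * leadCoeff a s m) := by
  obtain ⟨e, rfl⟩ := hd
  have h := growth_geomSeries_one_mul_partSeries hpos (s.erase i)
  rw [Finset.card_erase_of_mem hi, hm, Nat.add_sub_cancel] at h
  let Q : Polynomial ℝ := ∑ j ∈ Finset.range e, (Polynomial.X ^ a i) ^ j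
  have hQ : (1 - Polynomial.X ^ a i) * Q = 1 - Polynomial.X ^ (a i * e) := by
    rw [mul_neg_geom_sum, pow_mul]
  have hQ' : (1 - X ^ a i) * (Q : ℝ⟦X⟧) = 1 - X ^ (a i * e) := by
    simpa using congrArg (fun p : Polynomial ℝ => (p : ℝ⟦X⟧)) hQ
  have hQ1 : Q.eval 1 = e := by simp [Q, Polynomial.eval_finsetSum]
  have := h.polynomial_mul Q
  rw [hQ1, leadCoeff_erase hpos hi] at this
  convert this using 1
  · rw [← one_sub_X_pow_mul_partSeries hpos hi, mul_left_comm, ← mul_assoc (Q : ℝ⟦X⟧),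
      mul_comm (Q : ℝ⟦X⟧), hQ', ← one_sub_X_mul_windowPoly]
    have h1 : (1 - X) * geomSeries 1 = 1 := by
      simpa using one_sub_X_pow_mul_geomSeries one_pos
    linear_combination (-((windowPoly (a i * e) : ℝ⟦X⟧) * partSeries a s)) * h1
  · push_cast; ring

end partSeries

theorem pA_eq_coeff {a : ℕ → ℕ} (hpos : ∀ i, 0 < a i) (k n : ℕ) :
    (pA a k n : ℝ) = coeff n (partSeries a (Finset.range k)) := by
  classical
  set T := (Finset.finsuppAntidiag (Finset.univ : Finset (Fin k)) n).filter
    fun l => ∀ i : Fin k, a i ∣ l i with hT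
  have hcoeff : coeff n (partSeries a (Finset.range k)) = (T.card : ℝ) := by
    rw [partSeries, Finset.prod_range, coeff_prod, hT, Finset.card_filter, Nat.cast_sum]
    refine Finset.sum_congr rfl fun l _ => ?_
    simp only [geomSeries, coeff_mk, Finset.prod_ite_zero, Finset.prod_const_one,
      Finset.mem_univ, true_imp_iff]
    split_ifs <;> simp
  rw [hcoeff, pA, ← Set.ncard_coe_finset]
  congr 1
  refine Set.ncard_congr
    (fun c _ => Finsupp.equivFunOnFinite.symm fun i => c i * a i) ?_ ?_ ?_
  · intro c hc
    simp only [Set.mem_ofPred_eq] at hc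
    simp only [hT, Finset.coe_filter, Finset.mem_finsuppAntidiag, Set.mem_ofPred_eq,
      Finset.subset_univ, and_true, Finsupp.equivFunOnFinite_symm_apply_apply]
    exact ⟨by exact_mod_cast hc, fun i => dvd_mul_left _ _⟩
  · intro c c' _ _ h
    funext i
    have := DFunLike.congr_fun h i
    simp only [Finsupp.equivFunOnFinite_symm_apply_apply] at this
    exact Nat.eq_of_mul_eq_mul_right (hpos i) this
  · intro l hl
    simp only [hT, Finset.coe_filter, Finset.mem_finsuppAntidiag, Set.mem_ofPred_eq,
      Finset.subset_univ, and_true] at hl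
    have hdiv (i : Fin k) : l i / a i * a i = l i := Nat.div_mul_cancel (hl.2 i)
    refine ⟨fun i => l i / a i, ?_, ?_⟩
    · simp only [Set.mem_ofPred_eq]
      rw [← hl.1, Nat.cast_sum]
      exact Finset.sum_congr rfl fun i _ => by rw [← Nat.cast_mul, hdiv]
    · ext i
      simp [hdiv]

/-- The coefficients of `f` are `O(n ^ m)`. -/
abbrev CoeffBound (f : ℝ⟦X⟧) (m : ℕ) : Prop :=
  (fun n : ℕ => coeff n f) =O[atTop] fun n : ℕ => (n : ℝ) ^ m

namespace CoeffBound

variable {f g : ℝ⟦X⟧} {m : ℕ}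

theorem add (hf : CoeffBound f m) (hg : CoeffBound g m) : CoeffBound (f + g) m := by
  simpa [CoeffBound] using Asymptotics.IsBigO.add hf hg

theorem sub (hf : CoeffBound f m) (hg : CoeffBound g m) : CoeffBound (f - g) m := by
  simpa [CoeffBound] using Asymptotics.IsBigO.sub hf hg

theorem X_mul (hf : CoeffBound f m) : CoeffBound (X * f) m := by
  obtain ⟨C, hC, h⟩ := Asymptotics.IsBigO.exists_nonneg hf
  obtain ⟨N, hN⟩ := eventually_atTop.1 h.bound
  refine Asymptotics.IsBigO.of_bound C ?_
  filter_upwards [eventually_ge_atTop (N + 1)] with n hn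
  obtain ⟨n, rfl⟩ : ∃ k, n = k + 1 := ⟨n - 1, by lia⟩
  rw [coeff_succ_X_mul]
  refine (hN n (by lia)).trans (mul_le_mul_of_nonneg_left ?_ hC)
  rw [Real.norm_of_nonneg (by positivity), Real.norm_of_nonneg (by positivity)]
  gcongr
  simp

theorem X_pow_mul (hf : CoeffBound f m) (n : ℕ) : CoeffBound (X ^ n * f) m := by
  induction n with
  | zero => simpa using hf
  | succ n ih => rw [pow_succ', mul_assoc]; exact ih.X_mul

theorem polynomial_mul (hf : CoeffBound f m) (Q : Polynomial ℝ) :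
    CoeffBound ((Q : ℝ⟦X⟧) * f) m := by
  induction Q using Polynomial.induction_on' with
  | add p q hp hq => simpa [add_mul] using hp.add hq
  | monomial n a =>
    simpa [CoeffBound, ← Polynomial.C_mul_X_pow_eq_monomial, mul_assoc, coeff_C_mul]
      using Asymptotics.IsBigO.const_mul_left (hf.X_pow_mul n) a

theorem growth_zero (hf : CoeffBound f m) : CoeffGrowth f (m + 1) 0 := by
  have h : (fun n : ℕ => (n : ℝ) ^ m) =o[atTop] fun n : ℕ => (n : ℝ) ^ (m + 1) :=
    (Asymptotics.isLittleO_pow_pow_atTop_of_lt (𝕜 := ℝ) (Nat.lt_succ_self m)).comp_tendsto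
      tendsto_natCast_atTop_atTop
  exact (Asymptotics.IsBigO.trans_isLittleO hf h).tendsto_div_nhds_zero

theorem one_sub_X_pow_gcd {x y : ℕ} (hx : CoeffBound ((1 - X ^ x) * f) m)
    (hy : CoeffBound ((1 - X ^ y) * f) m) : CoeffBound ((1 - X ^ Nat.gcd x y) * f) m := by
  induction x, y using Nat.gcd.induction with
  | H0 y => simpa using hy
  | H1 x y _ ih =>
    rw [Nat.gcd_rec]
    refine ih ?_ hx
    have hmul (q : ℕ) : CoeffBound ((1 - X ^ (x * q)) * f) m := by
      induction q with
      | zero => simpa [CoeffBound] using Asymptotics.isBigO_zero _ _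
      | succ q ihq =>
        convert ihq.add (hx.X_pow_mul (x * q)) using 1
        ring
    convert hy.sub ((hmul (y / x)).X_pow_mul (y % x)) using 1
    have : (X : ℝ⟦X⟧) ^ y = X ^ (y % x) * X ^ (x * (y / x)) := by
      rw [← pow_add, Nat.mod_add_div]
    rw [this]
    ring

theorem one_sub_X_of_gcd {a : ℕ → ℕ} {t : Finset ℕ}
    (h : ∀ i ∈ t, CoeffBound ((1 - X ^ a i) * f) m) (ht : t.gcd a = 1) :
    CoeffBound ((1 - X) * f) m := by
  have key : CoeffBound ((1 - X ^ t.gcd a) * f) m := by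
    clear ht
    induction t using Finset.induction_on with
    | empty => simpa [CoeffBound] using Asymptotics.isBigO_zero _ _
    | insert i t hi ih =>
      rw [Finset.gcd_insert]
      exact one_sub_X_pow_gcd (h i (Finset.mem_insert_self i t))
        (ih fun j hj => h j (Finset.mem_insert_of_mem hj))
  simpa [ht] using key

end CoeffBound

theorem CoeffGrowth.of_coeffBound_one_sub_X_mul {f : ℝ⟦X⟧} {m : ℕ} {c : ℝ} {Q : Polynomial ℝ}
    (hQ : Q.eval 1 ≠ 0) (hf : CoeffBound ((1 - X) * f) m)
    (h : CoeffGrowth ((Q : ℝ⟦X⟧) * f) (m + 1) c) : CoeffGrowth f (m + 1) (c / Q.eval 1) := by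
  obtain ⟨R, hR⟩ := Polynomial.X_sub_C_dvd_sub_C_eval (a := (1 : ℝ)) (p := Q)
  have hR' : (Q : ℝ⟦X⟧) - C (Q.eval 1) = (X - 1) * (R : ℝ⟦X⟧) := by
    simpa using congrArg (fun p : Polynomial ℝ => (p : ℝ⟦X⟧)) hR
  have h₁ := HasGrowth.add h (hf.polynomial_mul R).growth_zero
  have h₂ := HasGrowth.const_mul h₁ (Q.eval 1)⁻¹
  rw [add_zero, ← div_eq_inv_mul] at h₂
  refine HasGrowth.congr' h₂ (Eventually.of_forall fun n => ?_)
  simp only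
  rw [inv_mul_eq_iff_eq_mul₀ hQ, ← map_add, ← coeff_C_mul]
  congr 1
  linear_combination f * hR'

section

variable {a : ℕ → ℕ} {s : Finset ℕ}

theorem coeffBound_partSeries (hpos : ∀ i, 0 < a i) {m : ℕ} (hm : s.card = m + 1) :
    CoeffBound (partSeries a s) m := by
  obtain ⟨i, hi⟩ := Finset.card_pos.1 (show 0 < s.card by lia)
  have h := growth_windowPoly_mul_partSeries hpos hi hm dvd_rfl
  set b : ℝ := a i * leadCoeff a s m
  refine Asymptotics.IsBigO.of_bound (b + 1) ?_
  filter_upwards [HasGrowth.eventually_le h (lt_add_one b),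
    eventually_ge_atTop (windowPoly (a i)).natDegree] with n hn hdeg
  rw [Real.norm_of_nonneg (partSeries_coeff_nonneg a s n), Real.norm_of_nonneg (by positivity)]
  refine le_trans ?_ hn
  rw [coeff_polynomial_mul _ _ hdeg]
  have h0 : (windowPoly (a i)).coeff 0 = 1 := by
    have := hpos i
    simp [windowPoly, Polynomial.coeff_X_pow, this]
  have := Finset.single_le_sum (s := Finset.range ((windowPoly (a i)).natDegree + 1))
    (f := fun j => (windowPoly (a i)).coeff j * coeff (n - j) (partSeries a s))
    (fun j _ => mul_nonneg (windowPoly_coeff_nonneg _ _) (partSeries_coeff_nonneg a s _))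
    (Finset.mem_range.2 (Nat.succ_pos _))
  simpa [h0] using this

theorem coeffBound_third_difference (hpos : ∀ i, 0 < a i) {m : ℕ} (hm : s.card = m + 4)
    (hgcd : ∀ t ⊆ s, t.card = m + 2 → t.gcd a = 1) :
    CoeffBound ((1 - X) * ((1 - X) * ((1 - X) * partSeries a s))) m := by
  have hgcd' (t : Finset ℕ) (hts : t ⊆ s) (ht : m + 2 ≤ t.card) : t.gcd a = 1 := by
    obtain ⟨r, hrt, hr⟩ := Finset.exists_subset_card_eq ht
    have := Finset.gcd_mono (f := a) hrt
    rw [hgcd r (hrt.trans hts) hr] at this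
    exact Nat.dvd_one.1 this
  refine CoeffBound.one_sub_X_of_gcd (fun i hi => ?_) (hgcd' s subset_rfl (by lia))
  have hi_card : (s.erase i).card = m + 3 := by rw [Finset.card_erase_of_mem hi]; lia
  rw [mul_left_comm, mul_left_comm (1 - X ^ a i), one_sub_X_pow_mul_partSeries hpos hi]
  refine CoeffBound.one_sub_X_of_gcd (fun j hj => ?_)
    (hgcd' (s.erase i) (Finset.erase_subset _ _) (by lia))
  have hj_card : ((s.erase i).erase j).card = m + 2 := by
    rw [Finset.card_erase_of_mem hj]; lia
  rw [mul_left_comm, one_sub_X_pow_mul_partSeries hpos hj]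
  refine CoeffBound.one_sub_X_of_gcd (fun l hl => ?_)
    (hgcd' _ ((Finset.erase_subset _ _).trans (Finset.erase_subset _ _)) hj_card.ge)
  rw [one_sub_X_pow_mul_partSeries hpos hl]
  exact coeffBound_partSeries hpos (by rw [Finset.card_erase_of_mem hl]; lia)

theorem windowPoly_mul_windowPoly_mul_second_difference (hpos : ∀ i, 0 < a i) {i j : ℕ}
    (hi : i ∈ s) (hj : j ∈ s.erase i) :
    ((windowPoly (a i) : ℝ⟦X⟧) * (windowPoly (a j) : ℝ⟦X⟧)) *
      ((1 - X) * ((1 - X) * partSeries a s)) = partSeries a ((s.erase i).erase j) := by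
  rw [← one_sub_X_pow_mul_partSeries hpos hj, ← one_sub_X_pow_mul_partSeries hpos hi,
    ← one_sub_X_mul_windowPoly, ← one_sub_X_mul_windowPoly]
  ring

theorem growth_second_difference (hpos : ∀ i, 0 < a i) {m : ℕ} (hm : s.card = m + 4)
    (hgcd : ∀ t ⊆ s, t.card = m + 2 → t.gcd a = 1) :
    CoeffGrowth ((1 - X) * ((1 - X) * partSeries a s)) (m + 1) (leadCoeff a s (m + 1)) := by
  obtain ⟨i, hi⟩ := Finset.card_pos.1 (show 0 < s.card by lia)
  have hi_card : (s.erase i).card = m + 3 := by rw [Finset.card_erase_of_mem hi]; lia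
  obtain ⟨j, hj⟩ := Finset.card_pos.1 (show 0 < (s.erase i).card by lia)
  have hj_card : ((s.erase i).erase j).card = m + 2 := by
    rw [Finset.card_erase_of_mem hj]; lia
  obtain ⟨l, hl⟩ := Finset.card_pos.1 (show 0 < ((s.erase i).erase j).card by lia)
  have h := growth_windowPoly_mul_partSeries hpos hl hj_card dvd_rfl
  rw [← windowPoly_mul_windowPoly_mul_second_difference hpos hi hj, ← mul_assoc,
    ← Polynomial.coe_mul, ← Polynomial.coe_mul, leadCoeff_erase hpos hj,
    leadCoeff_erase hpos hi] at h
  have hne (i : ℕ) : (a i : ℝ) ≠ 0 := by exact_mod_cast (hpos i).ne'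
  have := h.of_coeffBound_one_sub_X_mul (by simp [hne]) (coeffBound_third_difference hpos hm hgcd)
  convert this using 1
  have := hne i
  have := hne j
  have := hne l
  simp only [Polynomial.eval_mul, windowPoly_eval_one]
  field_simp

end

/-- The coefficients of `f` are eventually strictly log-concave. -/
def EventuallyLogConcave (f : ℝ⟦X⟧) : Prop :=
  ∀ᶠ n in atTop, coeff (n + 2) f * coeff n f < coeff (n + 1) f ^ 2

theorem coeff_succ_one_sub_X_mul (f : ℝ⟦X⟧) (n : ℕ) :
    coeff (n + 1) ((1 - X) * f) = coeff (n + 1) f - coeff n f := by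
  rw [sub_mul, one_mul, map_sub, coeff_succ_X_mul]

theorem EventuallyLogConcave.of_growth_second_difference {f : ℝ⟦X⟧} {m : ℕ} {c : ℝ}
    (hc : 0 < c) (h : CoeffGrowth ((1 - X) * ((1 - X) * f)) m c) : EventuallyLogConcave f := by
  have hd := h.of_one_sub_X_mul
  have hp := hd.of_one_sub_X_mul
  have h₁ := ((HasGrowth.shift_iff 2).2 hd).mul ((HasGrowth.shift_iff 1).2 hd)
  have h₂ := ((HasGrowth.shift_iff 1).2 hp).mul ((HasGrowth.shift_iff 2).2 h)
  rw [show m + 1 + 1 + m = m + 1 + (m + 1) by ring] at h₂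
  have h₃ := h₁.sub h₂
  have hlim : 0 < c / (m + 1) * (c / (m + 1)) - c / (m + 1) / (↑(m + 1) + 1) * c := by
    push_cast
    rw [div_mul_div_comm, div_div, div_mul_eq_mul_div, sub_pos]
    gcongr
    linarith
  filter_upwards [h₃.eventually_pos hlim] with n hn
  simp only [coeff_succ_one_sub_X_mul] at hn
  nlinarith

theorem EventuallyLogConcave.eventually_lt_succ {f : ℝ⟦X⟧} {q : ℕ → ℕ}
    (hq : ∀ n, coeff n f = q n) (h : EventuallyLogConcave f) :
    ∀ᶠ n in atTop, 0 < q n ∧ q n < q (n + 1) := by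
  obtain ⟨N, hN⟩ := eventually_atTop.1 h
  have hlc (n : ℕ) (hn : N ≤ n) : q (n + 2) * q n < q (n + 1) ^ 2 := by
    have := hN n hn
    simp only [hq] at this
    exact_mod_cast this
  have hpos (n : ℕ) (hn : N < n) : 0 < q n := by
    obtain ⟨n, rfl⟩ : ∃ k, n = k + 1 := ⟨n - 1, by lia⟩
    by_contra! h0
    have := hlc n (by lia)
    simp [Nat.le_zero.1 h0] at this
  have hstep (n : ℕ) (hn : N < n) (hle : q (n + 1) ≤ q n) : q (n + 2) < q (n + 1) := by
    by_contra! h'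
    have h₁ := hlc n hn.le
    have h₂ : q (n + 1) * q (n + 1) ≤ q (n + 2) * q n := Nat.mul_le_mul h' hle
    nlinarith
  filter_upwards [eventually_gt_atTop N] with n hn
  refine ⟨hpos n hn, ?_⟩
  by_contra! hle
  have hdec (j : ℕ) : q (n + 1 + j + 1) < q (n + 1 + j) := by
    induction j with
    | zero => exact hstep n hn hle
    | succ j ih => exact hstep (n + 1 + j) (by lia) ih.le
  exact not_strictAnti_of_wellFoundedLT _
    (strictAnti_nat_of_succ_lt (f := fun j => q (n + 1 + j)) hdec)

theorem EventuallyLogConcave.exists_difference_le {f : ℝ⟦X⟧} {l m : ℕ} {c b : ℝ}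
    {Q : Polynomial ℝ} (hf : EventuallyLogConcave f)
    (hmono : ∀ᶠ n in atTop, 0 < coeff n f ∧ coeff n f < coeff (n + 1) f)
    (hgrowth : CoeffGrowth f l c) (hc : c ≠ 0)
    (hQ : ∀ j, 0 ≤ Q.coeff j) (hQ1 : 0 < Q.eval 1)
    (h : CoeffGrowth ((Q : ℝ⟦X⟧) * ((1 - X) * f)) m b) :
    ∃ u : ℕ → ℝ, HasGrowth u m (b / Q.eval 1) ∧
      ∀ᶠ n in atTop, coeff n ((1 - X) * f) ≤ u n := by
  set T := Q.natDegree with hT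
  have hp := hgrowth.shift_back 1
  have hpT := hgrowth.shift_back (T + 1)
  have hratio : HasGrowth (fun n => coeff (n - 1) f / coeff (n - (T + 1)) f) 0 (c / c) :=
    HasGrowth.div (by simpa using hp) hpT hc
  refine ⟨fun n => (Q.eval 1)⁻¹ * (coeff n ((Q : ℝ⟦X⟧) * ((1 - X) * f)) *
    (coeff (n - 1) f / coeff (n - (T + 1)) f)), ?_, ?_⟩
  · have := (HasGrowth.mul h hratio).const_mul (Q.eval 1)⁻¹
    rwa [div_self hc, mul_one, ← div_eq_inv_mul] at this
  obtain ⟨N, hN⟩ := eventually_atTop.1 (hf.and hmono)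
  have hpm : ∀ i j, N ≤ i → i ≤ j → coeff i f ≤ coeff j f := fun i j hi hij =>
    Nat.le_induction le_rfl (fun k hk ih => ih.trans (hN k (hi.trans hk)).2.2.le) j hij
  let e : ℕ → ℝ := fun n => coeff (n + 1) ((1 - X) * f) / coeff n f
  have hanti : ∀ i j, N ≤ i → i ≤ j → e j ≤ e i := by
    intro i j hi hij
    refine Nat.le_induction le_rfl (fun k hk ih => le_trans ?_ ih) j hij
    obtain ⟨h₁, h₂, _⟩ := hN k (hi.trans hk)
    obtain ⟨_, h₃, _⟩ := hN (k + 1) (by lia)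
    simp only [e, coeff_succ_one_sub_X_mul]
    rw [div_le_div_iff₀ h₃ h₂]
    nlinarith
  filter_upwards [eventually_ge_atTop (N + T + 1)] with n hn
  obtain ⟨n, rfl⟩ : ∃ k, n = k + T + 1 := ⟨n - T - 1, by lia⟩
  have hn' : N ≤ n := by lia
  have he : 0 ≤ e (n + T) := by
    obtain ⟨_, h₂, h₃⟩ := hN (n + T) (by lia)
    simp only [e, coeff_succ_one_sub_X_mul]
    exact div_nonneg (by linarith) h₂.le
  have hp0 := (hN n hn').2.1
  have hpT0 := (hN (n + T) (by lia)).2.1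
  have key : Q.eval 1 * (e (n + T) * coeff n f) ≤
      coeff (n + T + 1) ((Q : ℝ⟦X⟧) * ((1 - X) * f)) := by
    rw [coeff_polynomial_mul _ _ (by lia), eval_one_eq_sum, Finset.sum_mul]
    refine Finset.sum_le_sum fun j hj => mul_le_mul_of_nonneg_left ?_ (hQ j)
    have hj' : j ≤ T := Nat.lt_succ_iff.1 (Finset.mem_range.1 hj)
    have hsub : n + T + 1 - j = (n + (T - j)) + 1 := by lia
    have hpj := (hN (n + (T - j)) (by lia)).2.1
    have : coeff (n + T + 1 - j) ((1 - X) * f) =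
        e (n + (T - j)) * coeff (n + (T - j)) f := by
      rw [hsub]
      simp only [e]
      field_simp
    rw [this]
    exact mul_le_mul (hanti _ _ (by lia) (by lia)) (hpm _ _ hn' (by lia)) hp0.le
      (he.trans (hanti _ _ (by lia) (by lia)))
  have h₁ : n + T + 1 - 1 = n + T := by lia
  have h₂ : n + T + 1 - (T + 1) = n := by lia
  simp only [h₁, h₂]
  rw [le_inv_mul_iff₀ hQ1]
  calc Q.eval 1 * coeff (n + T + 1) ((1 - X) * f)
      = Q.eval 1 * (e (n + T) * coeff n f) * (coeff (n + T) f / coeff n f) := by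
        simp only [e]
        field_simp
    _ ≤ _ := mul_le_mul_of_nonneg_right key (by positivity)

section

variable {a : ℕ → ℕ} {s : Finset ℕ}

theorem coeff_partSeries_eq_zero {g : ℕ} (hg : ∀ i ∈ s, g ∣ a i) {n : ℕ} (hn : ¬ g ∣ n) :
    coeff n (partSeries a s) = 0 := by
  induction s using Finset.induction_on generalizing n with
  | empty =>
    have : n ≠ 0 := fun h => hn (h ▸ dvd_zero g)
    simp [partSeries, coeff_one, this]
  | insert i s hi ih =>
    rw [partSeries, Finset.prod_insert hi, coeff_mul]
    refine Finset.sum_eq_zero fun x hx => ?_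
    by_cases h₁ : g ∣ x.1
    · have h₂ : ¬ g ∣ x.2 := fun h₂ =>
        hn (Finset.HasAntidiagonal.mem_antidiagonal.1 hx ▸ dvd_add h₁ h₂)
      have := ih (fun j hj => hg j (Finset.mem_insert_of_mem hj)) h₂
      rw [partSeries] at this
      rw [this, mul_zero]
    · have h₂ : ¬ a i ∣ x.1 := fun h₂ => h₁ ((hg i (Finset.mem_insert_self i s)).trans h₂)
      simp [geomSeries, h₂]

theorem coeff_windowPoly_mul (d : ℕ) (f : ℝ⟦X⟧) {n : ℕ} (hn : d ≤ n) :
    coeff n ((windowPoly d : ℝ⟦X⟧) * f) = ∑ j ∈ Finset.range d, coeff (n - j) f := by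
  rw [windowPoly, ← Polynomial.coeToPowerSeries.ringHom_apply, map_sum, Finset.sum_mul, map_sum]
  refine Finset.sum_congr rfl fun j hj => ?_
  have := Finset.mem_range.1 hj
  simp [coeff_X_pow_mul', show j ≤ n by lia]

/-- A partition function whose parts are all divisible by `g` is at least `g` times as large on
the multiples of `g` as it is on average. -/
theorem mul_leadCoeff_le_of_forall_dvd (hpos : ∀ i, 0 < a i) {m : ℕ} (hm : s.card = m + 1)
    {g : ℕ} (hg0 : 0 < g) (hg : ∀ i ∈ s, g ∣ a i) {c : ℝ} (hc : 0 ≤ c) {u : ℕ → ℝ}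
    (hu : HasGrowth u m c) (h : ∀ᶠ n in atTop, coeff n (partSeries a s) ≤ u n) :
    g * leadCoeff a s m ≤ c := by
  refine le_of_forall_pos_le_add fun ε hε => ?_
  obtain ⟨i, hi⟩ := Finset.card_pos.1 (show 0 < s.card by lia)
  have hai : (0 : ℝ) < a i := by exact_mod_cast hpos i
  have h₁ := (growth_windowPoly_mul_partSeries hpos hi hm dvd_rfl).polynomial_mul (windowPoly g)
  obtain ⟨N, hN⟩ := eventually_atTop.1 (h.and (hu.eventually_le (lt_add_of_pos_right c hε)))
  have hle : ∀ᶠ n in atTop, coeff n ((windowPoly g : ℝ⟦X⟧) * partSeries a s) ≤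
      coeff n (mk fun n : ℕ => (c + ε) * (n : ℝ) ^ m) := by
    filter_upwards [eventually_ge_atTop (N + g)] with n hn
    have hmod := Nat.mod_lt n hg0
    rw [coeff_windowPoly_mul _ _ (by lia), Finset.sum_eq_single (n % g), coeff_mk]
    · obtain ⟨h₂, h₃⟩ := hN (n - n % g) (by lia)
      refine (h₂.trans h₃).trans (mul_le_mul_of_nonneg_left ?_ (by positivity))
      gcongr
      exact Nat.sub_le _ _
    · intro j hj hne
      have hj' := Finset.mem_range.1 hj
      refine coeff_partSeries_eq_zero hg fun hdvd => hne ?_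
      have := (Nat.modEq_iff_dvd' (show j ≤ n by lia)).2 hdvd
      rw [← this, Nat.mod_eq_of_lt hj']
    · intro hnot
      exact absurd (Finset.mem_range.2 hmod) hnot
  have h₂ : CoeffGrowth (mk fun n : ℕ => (c + ε) * (n : ℝ) ^ m) m (c + ε) := by
    simpa [CoeffGrowth] using HasGrowth.pow_self m (c + ε)
  have h₃ := HasGrowth.le (by rwa [mul_left_comm] at h₁) (h₂.polynomial_mul (windowPoly (a i)))
    (CoeffGrowth.eventually_le_polynomial_mul (windowPoly_coeff_nonneg _) hle)
  rw [windowPoly_eval_one, windowPoly_eval_one, mul_left_comm] at h₃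
  exact le_of_mul_le_mul_left h₃ hai

theorem mul_leadCoeff_le_of_second_difference_le (hpos : ∀ i, 0 < a i) {m : ℕ}
    (hm : s.card = m + 3) {i j : ℕ} (hi : i ∈ s) (hj : j ∈ s.erase i) {g : ℕ} (hg0 : 0 < g)
    (hg : ∀ l ∈ (s.erase i).erase j, g ∣ a l) {c : ℝ} (hc : 0 ≤ c) {u : ℕ → ℝ}
    (hu : HasGrowth u m c)
    (h : ∀ᶠ n in atTop, coeff n ((1 - X) * ((1 - X) * partSeries a s)) ≤ u n) :
    g * leadCoeff a s m ≤ c := by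
  have hcard : ((s.erase i).erase j).card = m + 1 := by
    rw [Finset.card_erase_of_mem hj, Finset.card_erase_of_mem hi]; lia
  have hu' : CoeffGrowth (mk u) m c := by simpa [CoeffGrowth] using hu
  have h₁ := (hu'.polynomial_mul (windowPoly (a j))).polynomial_mul (windowPoly (a i))
  have h₂ : ∀ᶠ n in atTop, coeff n ((1 - X) * ((1 - X) * partSeries a s)) ≤ coeff n (mk u) := by
    simpa using h
  have h₃ := CoeffGrowth.eventually_le_polynomial_mul (windowPoly_coeff_nonneg (a i))
    (CoeffGrowth.eventually_le_polynomial_mul (windowPoly_coeff_nonneg (a j)) h₂)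
  rw [← mul_assoc, windowPoly_mul_windowPoly_mul_second_difference hpos hi hj] at h₃
  have hai : (0 : ℝ) < a i := by exact_mod_cast hpos i
  have haj : (0 : ℝ) < a j := by exact_mod_cast hpos j
  have h₄ := mul_leadCoeff_le_of_forall_dvd hpos hcard hg0 hg (by simp; positivity) h₁ h₃
  rw [leadCoeff_erase hpos hj, leadCoeff_erase hpos hi, windowPoly_eval_one,
    windowPoly_eval_one] at h₄
  refine le_of_mul_le_mul_left ?_ (mul_pos hai haj)
  linarith

theorem growth_partSeries_of_eventually_lt (hpos : ∀ i, 0 < a i) {m : ℕ}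
    (hm : s.card = m + 1)
    (hmono : ∀ᶠ n in atTop, 0 < coeff n (partSeries a s) ∧
      coeff n (partSeries a s) < coeff (n + 1) (partSeries a s)) :
    CoeffGrowth (partSeries a s) m (leadCoeff a s m) := by
  obtain ⟨i, hi⟩ := Finset.card_pos.1 (show 0 < s.card by lia)
  have hai : (0 : ℝ) < a i := by exact_mod_cast hpos i
  have h := (growth_windowPoly_mul_partSeries hpos hi hm dvd_rfl).of_eventually_monotone
    (windowPoly_coeff_nonneg _) (by simpa using hai) (hmono.mono fun n hn => hn.2.le)
  rwa [windowPoly_eval_one, mul_div_cancel_left₀ _ hai.ne'] at h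

theorem EventuallyLogConcave.exists_difference_partSeries_le (hpos : ∀ i, 0 < a i) {m : ℕ}
    (hm : s.card = m + 2) (hlc : EventuallyLogConcave (partSeries a s))
    (hmono : ∀ᶠ n in atTop, 0 < coeff n (partSeries a s) ∧
      coeff n (partSeries a s) < coeff (n + 1) (partSeries a s)) :
    ∃ u : ℕ → ℝ, HasGrowth u m (leadCoeff a s m) ∧
      ∀ᶠ n in atTop, coeff n ((1 - X) * partSeries a s) ≤ u n := by
  obtain ⟨i, hi⟩ := Finset.card_pos.1 (show 0 < s.card by lia)
  have hi_card : (s.erase i).card = m + 1 := by rw [Finset.card_erase_of_mem hi]; lia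
  obtain ⟨j, hj⟩ := Finset.card_pos.1 (show 0 < (s.erase i).card by lia)
  have hai : (0 : ℝ) < a i := by exact_mod_cast hpos i
  have haj : (0 : ℝ) < a j := by exact_mod_cast hpos j
  have h := growth_windowPoly_mul_partSeries hpos hj hi_card dvd_rfl
  have hQ : ∀ l, 0 ≤ (windowPoly (a j) * windowPoly (a i)).coeff l := fun l => by
    rw [Polynomial.coeff_mul]
    exact Finset.sum_nonneg fun x _ =>
      mul_nonneg (windowPoly_coeff_nonneg _ _) (windowPoly_coeff_nonneg _ _)
  rw [← one_sub_X_pow_mul_partSeries hpos hi, ← one_sub_X_mul_windowPoly,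
    mul_comm (1 - X), mul_assoc (windowPoly (a i) : ℝ⟦X⟧), ← mul_assoc,
    ← Polynomial.coe_mul] at h
  obtain ⟨u, hu, hle⟩ := hlc.exists_difference_le hmono
    (growth_partSeries_of_eventually_lt hpos hm hmono) (leadCoeff_pos hpos _ _).ne' hQ
    (by simpa using mul_pos haj hai) h
  refine ⟨u, ?_, hle⟩
  convert hu using 1
  rw [leadCoeff_erase hpos hi, Polynomial.eval_mul, windowPoly_eval_one, windowPoly_eval_one]
  field_simp

theorem EventuallyLogConcave.exists_second_difference_partSeries_le (hpos : ∀ i, 0 < a i)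
    {m : ℕ} (hm : s.card = m + 3) (hlc : EventuallyLogConcave (partSeries a s))
    (hmono : ∀ᶠ n in atTop, 0 < coeff n (partSeries a s) ∧
      coeff n (partSeries a s) < coeff (n + 1) (partSeries a s)) :
    ∃ u : ℕ → ℝ, HasGrowth u m ((m + 2) ^ 2 * leadCoeff a s (m + 2)) ∧
      ∀ᶠ n in atTop, coeff n ((1 - X) * ((1 - X) * partSeries a s)) ≤ u n := by
  obtain ⟨u, hu, hle⟩ := hlc.exists_difference_partSeries_le hpos hm hmono
  have hc := (leadCoeff_pos hpos s (m + 2)).ne'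
  have hp := growth_partSeries_of_eventually_lt hpos hm hmono
  have hU := hu.mul (hu.shift_back 1)
  rw [show m + 1 + (m + 1) = m + (m + 2) by ring] at hU
  have hU' := hU.div (hp.shift_back 1) hc
  refine ⟨fun n => u n * u (n - 1) / coeff (n - 1) (partSeries a s), ?_, ?_⟩
  · convert hU' using 1
    rw [leadCoeff_succ (m + 1)]
    push_cast
    field_simp
    ring
  · obtain ⟨N, hN⟩ := eventually_atTop.1 (hle.and (hlc.and hmono))
    filter_upwards [eventually_ge_atTop (N + 2)] with n hn
    obtain ⟨n, rfl⟩ : ∃ k, n = k + 2 := ⟨n - 2, by lia⟩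
    obtain ⟨-, hlc₀, hp₀, hp₁⟩ := hN n (by lia)
    obtain ⟨hu₁, -, hp₁', hp₂⟩ := hN (n + 1) (by lia)
    obtain ⟨hu₂, -⟩ := hN (n + 2) (by lia)
    simp only [coeff_succ_one_sub_X_mul] at hu₁ hu₂ ⊢
    rw [Nat.add_sub_cancel_right (n := n + 1) (m := 1), le_div_iff₀ hp₁']
    calc _ ≤ (coeff (n + 2) (partSeries a s) - coeff (n + 1) (partSeries a s)) *
          (coeff (n + 1) (partSeries a s) - coeff n (partSeries a s)) := by nlinarith
      _ ≤ _ := mul_le_mul hu₂ hu₁ (by linarith) (by linarith)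

end

theorem not_eventuallyLogConcave_of_second_difference_eq {f : ℝ⟦X⟧}
    (hf : (1 - X) * ((1 - X) * f) = geomSeries 2) : ¬ EventuallyLogConcave f := by
  have hw (n : ℕ) : coeff (n + 1) ((1 - X) * f) =
      coeff n ((1 - X) * f) + if 2 ∣ n + 1 then 1 else 0 := by
    have h := congrArg (coeff (n + 1)) hf
    rw [coeff_succ_one_sub_X_mul ((1 - X) * f), geomSeries, coeff_mk] at h
    linarith
  have hp (n : ℕ) : coeff (n + 1) f = coeff n f + coeff (n + 1) ((1 - X) * f) := by
    rw [coeff_succ_one_sub_X_mul]; ring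
  have hf₀ : coeff 0 f = 1 := by
    have := congrArg (coeff 0) hf
    simpa [geomSeries] using this
  have hd₀ : coeff 0 ((1 - X) * f) = 1 := by simpa using hf₀
  have key (t : ℕ) : coeff (2 * t) ((1 - X) * f) = (t + 1 : ℝ) ∧
      coeff (2 * t) f = (t + 1 : ℝ) ^ 2 ∧
      coeff (2 * t + 1) ((1 - X) * f) = (t + 1 : ℝ) ∧
      coeff (2 * t + 1) f = (t + 1 : ℝ) * (t + 2) := by
    have step (t : ℕ) (h₁ : coeff (2 * t) ((1 - X) * f) = (t + 1 : ℝ))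
        (h₂ : coeff (2 * t) f = (t + 1 : ℝ) ^ 2) :
        coeff (2 * t + 1) ((1 - X) * f) = (t + 1 : ℝ) ∧
          coeff (2 * t + 1) f = (t + 1 : ℝ) * (t + 2) := by
      have h₃ : coeff (2 * t + 1) ((1 - X) * f) = (t + 1 : ℝ) := by
        rw [hw, h₁, if_neg (by lia), add_zero]
      exact ⟨h₃, by rw [hp, h₂, h₃]; ring⟩
    induction t with
    | zero =>
      have h := step 0 (by simpa using hd₀) (by simpa using hf₀)
      exact ⟨by simpa using hd₀, by simpa using hf₀, h⟩
    | succ t ih =>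
      obtain ⟨-, -, h₁, h₂⟩ := ih
      have h₃ : coeff (2 * (t + 1)) ((1 - X) * f) = ((t + 1 : ℕ) + 1 : ℝ) := by
        rw [mul_add, mul_one, hw (2 * t + 1), h₁, if_pos (by lia)]
        push_cast; ring
      have h₄ : coeff (2 * (t + 1)) f = ((t + 1 : ℕ) + 1 : ℝ) ^ 2 := by
        rw [mul_add, mul_one, hp (2 * t + 1), h₂, show 2 * t + 1 + 1 = 2 * (t + 1) by ring, h₃]
        push_cast; ring
      exact ⟨h₃, h₄, step (t + 1) h₃ h₄⟩
  intro h
  obtain ⟨N, hN⟩ := eventually_atTop.1 h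
  have := hN (2 * N) (by lia)
  rw [(key N).2.1, (key N).2.2.2, show 2 * N + 2 = 2 * (N + 1) by ring, (key (N + 1)).2.1] at this
  push_cast at this
  nlinarith

theorem exists_pA_log_concave_iff {a : ℕ → ℕ} (hpos : ∀ i, 0 < a i) (k : ℕ) :
    (∃ N : ℕ, ∀ n : ℕ, N < n →
        pA a k ((n : ℤ) + 1) * pA a k ((n : ℤ) - 1) < pA a k (n : ℤ) ^ 2) ↔
      EventuallyLogConcave (partSeries a (Finset.range k)) := by
  have key (n : ℕ) : pA a k (((n + 1 : ℕ) : ℤ) + 1) * pA a k (((n + 1 : ℕ) : ℤ) - 1) <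
      pA a k ((n + 1 : ℕ) : ℤ) ^ 2 ↔
      coeff (n + 2) (partSeries a (Finset.range k)) * coeff n (partSeries a (Finset.range k)) <
        coeff (n + 1) (partSeries a (Finset.range k)) ^ 2 := by
    rw [show (((n + 1 : ℕ) : ℤ) + 1) = ((n + 2 : ℕ) : ℤ) by push_cast; ring,
      show (((n + 1 : ℕ) : ℤ) - 1) = (n : ℤ) by push_cast; ring,
      ← pA_eq_coeff hpos, ← pA_eq_coeff hpos, ← pA_eq_coeff hpos]
    norm_cast
  constructor
  · rintro ⟨N, hN⟩
    filter_upwards [eventually_ge_atTop N] with n hn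
    exact (key n).1 (hN (n + 1) (by lia))
  · intro h
    obtain ⟨N, hN⟩ := eventually_atTop.1 h
    refine ⟨N, fun n hn => ?_⟩
    obtain ⟨n, rfl⟩ : ∃ j, n = j + 1 := ⟨n - 1, by lia⟩
    exact (key n).2 (hN n (by lia))

theorem partSeries_range_of_eq_one {a : ℕ → ℕ} (hpos : ∀ i, 0 < a i) {k : ℕ} (hk : a k = 1) :
    (1 - X) * partSeries a (Finset.range (k + 1)) = partSeries a (Finset.range k) := by
  have h := one_sub_X_pow_mul_partSeries hpos (Finset.self_mem_range_succ k)
  rwa [hk, pow_one, show (Finset.range (k + 1)).erase k = Finset.range k by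
    rw [Finset.range_add_one, Finset.erase_insert Finset.notMem_range_self]] at h

theorem eventuallyLogConcave_of_forall_eq_one {a : ℕ → ℕ} (hpos : ∀ i, 0 < a i) {k : ℕ}
    (hk : 2 ≤ k) (ha : ∀ i < k, a i = 1) :
    EventuallyLogConcave (partSeries a (Finset.range k)) := by
  obtain ⟨k, rfl⟩ : ∃ j, k = j + 2 := ⟨k - 2, by lia⟩
  have h₁ := partSeries_range_of_eq_one hpos (ha (k + 1) (by lia))
  have h₂ := partSeries_range_of_eq_one hpos (ha k (by lia))
  rcases k with _ | k
  · have hw (n : ℕ) : coeff (n + 1) ((1 - X) * ((1 - X) * partSeries a (Finset.range 2))) = 0 := by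
      rw [h₁, h₂]
      simp [partSeries, coeff_one]
    have hd (n : ℕ) : coeff n ((1 - X) * partSeries a (Finset.range 2)) = 1 := by
      induction n with
      | zero => rw [h₁]; simp [partSeries, geomSeries]
      | succ n ih =>
        have := hw n
        rw [coeff_succ_one_sub_X_mul ((1 - X) * partSeries a (Finset.range 2))] at this
        linarith
    refine Eventually.of_forall fun n => ?_
    have h₃ := hd (n + 1)
    have h₄ := hd (n + 2)
    rw [coeff_succ_one_sub_X_mul] at h₃ h₄
    rw [sub_eq_iff_eq_add'] at h₃ h₄
    simp only [zero_add]
    rw [h₄, h₃]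
    nlinarith
  · have h₃ := growth_windowPoly_mul_partSeries hpos (Finset.self_mem_range_succ k)
      (Finset.card_range (k + 1)) dvd_rfl
    have hone : (windowPoly 1 : ℝ⟦X⟧) = 1 := by simp [windowPoly]
    rw [ha k (by lia), hone, one_mul, Nat.cast_one, one_mul, ← h₂, ← h₁] at h₃
    exact .of_growth_second_difference (leadCoeff_pos hpos _ _) h₃

section

variable {a : ℕ → ℕ} {s : Finset ℕ}

theorem card_ne_one_of_eventually_add_one_le (hpos : ∀ i, 0 < a i)
    (hmono : ∀ᶠ n in atTop, 0 < coeff n (partSeries a s) ∧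
      coeff n (partSeries a s) + 1 ≤ coeff (n + 1) (partSeries a s)) : s.card ≠ 1 := by
  intro hs
  have h := growth_partSeries_of_eventually_lt hpos hs
    (hmono.mono fun n hn => ⟨hn.1, by linarith [hn.2]⟩)
  have h₁ := ((HasGrowth.shift_iff 1).2 h).sub h
  have := HasGrowth.le (HasGrowth.pow_self 0 1) h₁
    (hmono.mono fun n hn => by simp only [pow_zero]; linarith [hn.2])
  linarith

theorem EventuallyLogConcave.prod_le_one_of_card_eq_two (hpos : ∀ i, 0 < a i)
    (hlc : EventuallyLogConcave (partSeries a s)) (hs : s.card = 2)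
    (hmono : ∀ᶠ n in atTop, 0 < coeff n (partSeries a s) ∧
      coeff n (partSeries a s) + 1 ≤ coeff (n + 1) (partSeries a s)) : ∏ i ∈ s, a i ≤ 1 := by
  obtain ⟨u, hu, hle⟩ := hlc.exists_difference_partSeries_le (m := 0) hpos hs
    (hmono.mono fun n hn => ⟨hn.1, by linarith [hn.2]⟩)
  have h := HasGrowth.le (HasGrowth.pow_self 0 1) ((HasGrowth.shift_iff 1).2 hu) (by
    filter_upwards [hmono, (tendsto_add_atTop_nat 1).eventually hle] with n hn hn'
    rw [coeff_succ_one_sub_X_mul] at hn'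
    simp only [pow_zero]
    linarith [hn.2])
  have hprod : (0 : ℝ) < ∏ i ∈ s, (a i : ℝ) := Finset.prod_pos fun i _ => by exact_mod_cast hpos i
  rw [leadCoeff, Nat.factorial_zero, Nat.cast_one, one_mul, le_div_iff₀ hprod, one_mul] at h
  exact_mod_cast h

theorem EventuallyLogConcave.prod_le_two_of_card_eq_three (hpos : ∀ i, 0 < a i)
    (hlc : EventuallyLogConcave (partSeries a s)) (hs : s.card = 3) {q : ℕ → ℕ}
    (hq : ∀ n, coeff n (partSeries a s) = q n) : ∏ i ∈ s, a i ≤ 2 := by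
  have hmono : ∀ᶠ n in atTop, 0 < coeff n (partSeries a s) ∧
      coeff n (partSeries a s) < coeff (n + 1) (partSeries a s) := by
    simp only [hq]
    exact_mod_cast hlc.eventually_lt_succ hq
  by_contra! hprod
  obtain ⟨u, hu, hle⟩ := hlc.exists_second_difference_partSeries_le (m := 0) hpos hs hmono
  obtain ⟨i, hi⟩ := Finset.card_pos.1 (show 0 < s.card by lia)
  have hi_card : (s.erase i).card = 2 := by rw [Finset.card_erase_of_mem hi]; lia
  obtain ⟨j, hj⟩ := Finset.card_pos.1 (show 0 < (s.erase i).card by lia)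
  have hlt : ((0 : ℕ) + 2 : ℝ) ^ 2 * leadCoeff a s (0 + 2) < 1 := by
    have : (3 : ℝ) ≤ ∏ i ∈ s, (a i : ℝ) := by exact_mod_cast hprod
    rw [leadCoeff, mul_one_div, div_lt_one (by positivity)]
    norm_num [Nat.factorial]
    linarith
  have hu' : Tendsto u atTop (𝓝 (((0 : ℕ) + 2 : ℝ) ^ 2 * leadCoeff a s (0 + 2))) := by
    simpa [HasGrowth] using hu
  have hneg : ∀ᶠ n in atTop, coeff n ((1 - X) * ((1 - X) * partSeries a s)) ≤ 0 := by
    obtain ⟨N, hN⟩ := eventually_atTop.1 (hle.and (hu'.eventually_lt_const hlt))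
    filter_upwards [eventually_ge_atTop (N + 2)] with n hn
    obtain ⟨n, rfl⟩ : ∃ k, n = k + 2 := ⟨n - 2, by lia⟩
    obtain ⟨h₁, h₂⟩ := hN (n + 2) (by lia)
    have h₃ := h₁.trans_lt h₂
    simp only [coeff_succ_one_sub_X_mul, hq] at h₃ ⊢
    have h₄ : ((q (n + 2) : ℤ) - q (n + 1) - (q (n + 1) - q n)) < 1 := by exact_mod_cast h₃
    have h₅ : ((q (n + 2) : ℤ) - q (n + 1) - (q (n + 1) - q n)) ≤ 0 := by lia
    exact_mod_cast h₅
  have := mul_leadCoeff_le_of_second_difference_le hpos hs hi hj one_pos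
    (fun l _ => one_dvd _) le_rfl (by simpa using HasGrowth.pow_self 0 0) hneg
  have hc := leadCoeff_pos hpos s 0
  rw [Nat.cast_one, one_mul] at this
  linarith

theorem EventuallyLogConcave.gcd_eq_one (hpos : ∀ i, 0 < a i)
    (hlc : EventuallyLogConcave (partSeries a s)) {m : ℕ} (hs : s.card = m + 4)
    (hmono : ∀ᶠ n in atTop, 0 < coeff n (partSeries a s) ∧
      coeff n (partSeries a s) < coeff (n + 1) (partSeries a s))
    {t : Finset ℕ} (hts : t ⊆ s) (ht : t.card = m + 2) : t.gcd a = 1 := by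
  have hcard : (s \ t).card = 2 := by rw [Finset.card_sdiff_of_subset hts]; lia
  obtain ⟨i, j, hij, hst⟩ := Finset.card_eq_two.1 hcard
  have hi : i ∈ s \ t := by simp [hst]
  have hj : j ∈ s \ t := by simp [hst]
  rw [Finset.mem_sdiff] at hi hj
  have hg0 : 0 < t.gcd a := by
    obtain ⟨l, hl⟩ := Finset.card_pos.1 (show 0 < t.card by lia)
    exact Nat.pos_of_dvd_of_pos (Finset.gcd_dvd hl) (hpos l)
  obtain ⟨u, hu, hle⟩ := hlc.exists_second_difference_partSeries_le (m := m + 1) hpos hs hmono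
  have hc := leadCoeff_pos hpos s (m + 1 + 2)
  have h := mul_leadCoeff_le_of_second_difference_le (m := m + 1) hpos hs hi.1
    (Finset.mem_erase.2 ⟨hij.symm, hj.1⟩) hg0 (fun l hl => ?_) (by positivity) hu hle
  · rw [leadCoeff_succ, leadCoeff_succ] at h
    push_cast at h
    rw [show (m : ℝ) + 1 + 2 = m + 1 + 1 + 1 by ring, pow_two,
      show m + 1 + 1 + 1 = m + 1 + 2 from rfl] at h
    have h' : ((t.gcd a : ℕ) : ℝ) * (m + 1 + 1) ≤ m + 1 + 1 + 1 := by
      refine le_of_mul_le_mul_right ?_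
        (show 0 < ((m : ℝ) + 1 + 1 + 1) * leadCoeff a s (m + 1 + 2) by positivity)
      linarith
    have h'' : t.gcd a * (m + 1 + 1) ≤ m + 1 + 1 + 1 := by exact_mod_cast h'
    nlinarith
  · simp only [Finset.mem_erase] at hl
    refine Finset.gcd_dvd ?_
    by_contra hlt
    have : l ∈ s \ t := Finset.mem_sdiff.2 ⟨hl.2.2, hlt⟩
    rw [hst] at this
    simp [hl.1, hl.2.1] at this

end

theorem stmt19 (a : ℕ → ℕ) (hpos : ∀ i, 0 < a i) (hmono : Monotone a)
    (k : ℕ) (hk : 1 ≤ k) :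
    (∃ N : ℕ, ∀ n : ℕ, N < n →
        pA a k ((n : ℤ) + 1) * pA a k ((n : ℤ) - 1) < pA a k (n : ℤ) ^ 2) ↔
      ((2 ≤ k ∧ ∀ i < k, a i = 1) ∨
        (4 ≤ k ∧ ∀ s : Finset ℕ, s ⊆ Finset.range k → s.card = k - 2 → s.gcd a = 1)) := by
  rw [exists_pA_log_concave_iff hpos]
  constructor
  · intro hlc
    have hq (n : ℕ) := (pA_eq_coeff hpos k n).symm
    have hlt' := hlc.eventually_lt_succ (q := fun n => pA a k n) hq
    have hsucc : ∀ᶠ n in atTop, 0 < coeff n (partSeries a (Finset.range k)) ∧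
        coeff n (partSeries a (Finset.range k)) + 1 ≤
          coeff (n + 1) (partSeries a (Finset.range k)) := by
      filter_upwards [hlt'] with n hn
      rw [hq, hq]
      exact_mod_cast hn
    have hlt := hsucc.mono fun n hn =>
      (⟨hn.1, by linarith [hn.2]⟩ : 0 < coeff n (partSeries a (Finset.range k)) ∧
        coeff n (partSeries a (Finset.range k)) < coeff (n + 1) (partSeries a (Finset.range k)))
    have hcard := Finset.card_range k
    obtain rfl | rfl | rfl | hk4 : k = 1 ∨ k = 2 ∨ k = 3 ∨ 4 ≤ k := by lia
    · exact absurd hcard (card_ne_one_of_eventually_add_one_le hpos hsucc)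
    · have h := hlc.prod_le_one_of_card_eq_two hpos hcard hsucc
      simp only [Finset.prod_range_succ, Finset.prod_range_zero, one_mul] at h
      have h₀ := hpos 0
      have h₁ := hpos 1
      refine .inl ⟨le_rfl, fun i hi => ?_⟩
      interval_cases i <;> nlinarith
    · have h := hlc.prod_le_two_of_card_eq_three hpos hcard hq
      simp only [Finset.prod_range_succ, Finset.prod_range_zero, one_mul] at h
      have h₀ := hpos 0
      have h₁ := hpos 1
      have h₂ := hpos 2
      have h₀₁ : a 0 ≤ a 1 := hmono (by norm_num)
      have h₁₂ : a 1 ≤ a 2 := hmono (by norm_num)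
      have h₁' : a 1 = 1 := by
        by_contra hne
        have h₁₁ : 2 * 2 ≤ a 1 * a 2 := Nat.mul_le_mul (by lia) (by lia)
        nlinarith
      have h₀' : a 0 = 1 := by lia
      rw [h₀', h₁', one_mul, one_mul] at h
      obtain h₂' | h₂' : a 2 = 1 ∨ a 2 = 2 := by lia
      · refine .inl ⟨by norm_num, fun i hi => ?_⟩
        interval_cases i <;> assumption
      · refine absurd hlc (not_eventuallyLogConcave_of_second_difference_eq ?_)
        have hg : (1 - X) * geomSeries 1 = 1 := by
          simpa using one_sub_X_pow_mul_geomSeries one_pos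
        simp only [partSeries, Finset.prod_range_succ, Finset.prod_range_zero, one_mul, h₀', h₁',
          h₂']
        linear_combination ((1 - X) * geomSeries 1 * geomSeries 2 + geomSeries 2) * hg
    · obtain ⟨m, rfl⟩ : ∃ m, k = m + 4 := ⟨k - 4, by lia⟩
      exact .inr ⟨hk4, fun t hts ht => hlc.gcd_eq_one hpos hcard hlt hts (by lia)⟩
  · rintro (⟨hk2, ha⟩ | ⟨hk4, hgcd⟩)
    · exact eventuallyLogConcave_of_forall_eq_one hpos hk2 ha
    · obtain ⟨m, rfl⟩ : ∃ m, k = m + 4 := ⟨k - 4, by lia⟩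
      exact .of_growth_second_difference (leadCoeff_pos hpos _ _)
        (growth_second_difference hpos (Finset.card_range _) fun t hts ht =>
          hgcd t hts (by lia))
end
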